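/- arXiv:2501.15221 — 10 statements merged into one kernel-verified Lean document; each statement's English description precedes it below -/
import Mathlib

section
/- Let S, T ⊆ {1,…,n} be disjoint index sets with |S| ≤ s and |T| ≤ k. Suppose the matrix A ∈ ℝ^{m×n} satisfies the order-(s+k) restricted isometry property with constants 0 < δ_{s+k,l} < 1 and δ_{s+k,u} > 0, and set δ_{s+k} = max{δ_{s+k,l}, δ_{s+k,u}}. Then for all x, x′ ∈ ℝⁿ with x supported on S and x′ supported on T, one has |⟨Ax, Ax′⟩| ≤ δ_{s+k} ‖x‖₂ ‖x′‖₂. -/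
open scoped BigOperators

/-- A vector is `k`-sparse if it has at most `k` nonzero entries. -/
def Sparse {n : ℕ} (k : ℕ) (x : Fin n → ℝ) : Prop :=
  ∃ S : Finset (Fin n), S.card ≤ k ∧ ∀ i ∉ S, x i = 0

/-- Order-`K` restricted isometry property with lower constant `δl` and upper constant `δu`. -/
def RIP {m n : ℕ} (A : Matrix (Fin m) (Fin n) ℝ) (K : ℕ) (δl δu : ℝ) : Prop :=
  ∀ z : Fin n → ℝ, Sparse K z →
    (1 - δl) * (∑ i, z i ^ 2) ≤ (∑ i, A.mulVec z i ^ 2) ∧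
      (∑ i, A.mulVec z i ^ 2) ≤ (1 + δu) * (∑ i, z i ^ 2)

/-- The Euclidean (ℓ₂) norm of a vector. -/
noncomputable def l2norm {n : ℕ} (x : Fin n → ℝ) : ℝ := Real.sqrt (∑ i, x i ^ 2)

theorem stmt0 {m n : ℕ} (A : Matrix (Fin m) (Fin n) ℝ) (S T : Finset (Fin n))
    (s k : ℕ) (hdisj : Disjoint S T) (hS : S.card ≤ s) (hT : T.card ≤ k)
    (δl δu : ℝ) (hδl0 : 0 < δl) (hδl1 : δl < 1) (hδu0 : 0 < δu)
    (hRIP : RIP A (s + k) δl δu)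
    (x x' : Fin n → ℝ) (hx : ∀ i, i ∉ S → x i = 0) (hx' : ∀ i, i ∉ T → x' i = 0) :
    |∑ i, A.mulVec x i * A.mulVec x' i| ≤ max δl δu * (l2norm x * l2norm x') := by
  have key : ∀ a b : ℝ,
      (1 - max δl δu) * (a^2 * (∑ i, x i ^ 2) + b^2 * (∑ i, x' i ^ 2)) ≤
        a^2 * (∑ i, A.mulVec x i ^ 2) + 2 * a * b * (∑ i, A.mulVec x i * A.mulVec x' i)
          + b^2 * (∑ i, A.mulVec x' i ^ 2) ∧
      a^2 * (∑ i, A.mulVec x i ^ 2) + 2 * a * b * (∑ i, A.mulVec x i * A.mulVec x' i)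
          + b^2 * (∑ i, A.mulVec x' i ^ 2) ≤
        (1 + max δl δu) * (a^2 * (∑ i, x i ^ 2) + b^2 * (∑ i, x' i ^ 2)) := by
    intro a b
    have h := hRIP (a • x + b • x') ⟨S ∪ T,
      (Finset.card_union_le S T).trans (add_le_add hS hT), by
        intro i hi
        rw [Finset.mem_union, not_or] at hi
        simp [hx i hi.1, hx' i hi.2]⟩
    have e1 : ∑ i, (a • x + b • x') i ^ 2
        = a^2 * (∑ i, x i ^ 2) + b^2 * (∑ i, x' i ^ 2) := by
      rw [Finset.mul_sum, Finset.mul_sum, ← Finset.sum_add_distrib]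
      refine Finset.sum_congr rfl fun i _ => ?_
      have h0 : x i * x' i = 0 := by
        by_cases hi : i ∈ S
        · rw [hx' i (Finset.disjoint_left.mp hdisj hi), mul_zero]
        · rw [hx i hi, zero_mul]
      simp only [Pi.add_apply, Pi.smul_apply, smul_eq_mul]
      linear_combination (2 * a * b) * h0
    have e2 : ∑ i, A.mulVec (a • x + b • x') i ^ 2
        = a^2 * (∑ i, A.mulVec x i ^ 2) + 2 * a * b * (∑ i, A.mulVec x i * A.mulVec x' i)
          + b^2 * (∑ i, A.mulVec x' i ^ 2) := by
      rw [Finset.mul_sum, Finset.mul_sum, Finset.mul_sum, ← Finset.sum_add_distrib,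
        ← Finset.sum_add_distrib]
      refine Finset.sum_congr rfl fun i _ => ?_
      rw [Matrix.mulVec_add, Matrix.mulVec_smul, Matrix.mulVec_smul]
      simp only [Pi.add_apply, Pi.smul_apply, smul_eq_mul]
      ring
    rw [e1, e2] at h
    have hn : 0 ≤ a^2 * (∑ i, x i ^ 2) + b^2 * (∑ i, x' i ^ 2) := by positivity
    have m1 := mul_le_mul_of_nonneg_right (le_max_left δl δu) hn
    have m2 := mul_le_mul_of_nonneg_right (le_max_right δl δu) hn
    constructor <;> linarith [h.1, h.2]
  have zero : ∀ y : Fin n → ℝ, l2norm y = 0 → y = 0 := by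
    intro y hy
    unfold l2norm at hy
    rw [Real.sqrt_eq_zero (by positivity),
      Finset.sum_eq_zero_iff_of_nonneg (fun i _ => sq_nonneg _)] at hy
    funext i
    simpa using hy i (Finset.mem_univ i)
  by_cases h1 : l2norm x = 0
  · rw [h1]; simp [zero x h1]
  by_cases h2 : l2norm x' = 0
  · rw [h2]; simp [zero x' h2]
  have q1 : l2norm x ^ 2 = ∑ i, x i ^ 2 := Real.sq_sqrt (by positivity)
  have q2 : l2norm x' ^ 2 = ∑ i, x' i ^ 2 := Real.sq_sqrt (by positivity)
  have p1 : 0 < l2norm x := lt_of_le_of_ne (Real.sqrt_nonneg _) (Ne.symm h1)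
  have p2 : 0 < l2norm x' := lt_of_le_of_ne (Real.sqrt_nonneg _) (Ne.symm h2)
  have k1 := key (l2norm x') (l2norm x)
  have k2 := key (l2norm x') (-l2norm x)
  rw [← q1, ← q2] at k1 k2
  have p := mul_pos p1 p2
  rw [abs_le]
  constructor
  · refine le_of_mul_le_mul_left ?_ p
    linarith [k1.1, k2.2]
  · refine le_of_mul_le_mul_left ?_ p
    linarith [k1.2, k2.1]
end

section
/- Let T ⊆ {1,…,n} with |T| = k_T, let k ≥ 1 be an integer, let a > 0, and set K = max{(a+1)k + k_T, 2ak}. Suppose A ∈ ℝ^{m×n} satisfies the order-K RIP with constants 0 < δ_{K,l} < 1 and δ_{K,u} > 0, and that a > 2δ_K²/(1−δ_{K,l})², where δ_K = max{δ_{K,l}, δ_{K,u}}. Then for every x ∈ ℝⁿ and every w ∈ ℝ^m with ‖w‖₂ ≤ ε, any solution ẑ of the tail-ℓ₁ minimization problem with y = Ax + w satisfies ‖ẑ − x‖₂ ≤ C₁ ε + C₂ ‖x_{T^c ∩ S₀^c}‖₁ / √(ak), where S₀ ⊆ T^c is a set of k indices of the largest-magnitude entries of x_{T^c}, C₁ =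 2(√a + 1)√(1+δ_K) / (√a(1−δ_{K,l}) − √2 δ_K), and C₂ = 2√2(√a + 1)δ_K / (√a(1−δ_{K,l}) − √2 δ_K) + 2. -/
open scoped BigOperators

/-- The ℓ₁ norm of the restriction of a vector to an index set `S`. -/
def l1normOn {n : ℕ} (S : Finset (Fin n)) (x : Fin n → ℝ) : ℝ := ∑ i ∈ S, |x i|


namespace TailL1

lemma exists_top {n : ℕ} (h : Fin n → ℝ) (R : Finset (Fin n)) (s : ℕ) :
    ∃ Q ⊆ R, Q.card ≤ s ∧ ∃ M : ℝ, 0 ≤ M ∧ (∀ j ∈ R \ Q, |h j| ≤ M) ∧ (∀ i ∈ Q, M ≤ |h i|) ∧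
      (Q.card = s ∨ (Q = R ∧ M = 0)) := by
  induction s with
  | zero =>
    refine ⟨∅, by simp, by simp, ∑ i ∈ R, |h i|, Finset.sum_nonneg (fun i _ => abs_nonneg _), ?_, by simp, by simp⟩
    intro j hj
    simp only [Finset.sdiff_empty] at hj
    exact Finset.single_le_sum (f := fun i => |h i|) (fun i _ => abs_nonneg _) hj
  | succ s ih =>
    obtain ⟨Q, hQ, hc, M, hM, h1, h2, h3⟩ := ih
    rcases h3 with h3 | ⟨h3, h4⟩
    · by_cases hne : (R \ Q).Nonempty
      · obtain ⟨b, hb, hmax⟩ := Finset.exists_max_image (R \ Q) (fun i => |h i|) hne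
        rw [Finset.mem_sdiff] at hb
        refine ⟨insert b Q, ?_, ?_, |h b|, abs_nonneg _, ?_, ?_, ?_⟩
        · intro i hi
          rcases Finset.mem_insert.1 hi with rfl | hi
          · exact hb.1
          · exact hQ hi
        · rw [Finset.card_insert_of_notMem hb.2]; omega
        · intro j hj
          apply hmax
          simp only [Finset.mem_sdiff, Finset.mem_insert, not_or] at hj ⊢
          exact ⟨hj.1, hj.2.2⟩
        · intro i hi
          rcases Finset.mem_insert.1 hi with rfl | hi
          · exact le_rfl
          · exact (h1 b (Finset.mem_sdiff.2 hb)).trans (h2 i hi)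
        · left; rw [Finset.card_insert_of_notMem hb.2]; omega
      · have hRQ : R ⊆ Q := by
          rw [Finset.not_nonempty_iff_eq_empty] at hne
          exact Finset.sdiff_eq_empty_iff_subset.1 hne
        have : Q = R := Finset.Subset.antisymm hQ hRQ
        refine ⟨Q, hQ, by omega, 0, le_rfl, ?_, fun i _ => abs_nonneg _, Or.inr ⟨this, rfl⟩⟩
        intro j hj; subst this; simp at hj
    · exact ⟨Q, hQ, by omega, M, hM, h1, h2, Or.inr ⟨h3, h4⟩⟩

lemma block {n : ℕ} (h : Fin n → ℝ) (Q : Finset (Fin n)) (s : ℕ) (hs : 1 ≤ s) (M m : ℝ)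
    (hm : 0 ≤ m) (hMm : m ≤ M) (h1 : ∀ i ∈ Q, m ≤ |h i|) (h2 : ∀ i ∈ Q, |h i| ≤ M)
    (hc : Q.card = s ∨ m = 0) :
    Real.sqrt (∑ i ∈ Q, h i ^ 2) ≤ (∑ i ∈ Q, |h i|) / Real.sqrt s + Real.sqrt s / 4 * (M - m) := by
  have hs0 : (0:ℝ) < s := by exact_mod_cast hs
  set S := ∑ i ∈ Q, |h i| with hS
  have hS0 : 0 ≤ S := Finset.sum_nonneg (fun i _ => abs_nonneg _)
  have key : ∑ i ∈ Q, h i ^ 2 ≤ (M + m) * S - s * (M * m) := by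
    have : ∑ i ∈ Q, h i ^ 2 ≤ ∑ i ∈ Q, ((M + m) * |h i| - M * m) := by
      apply Finset.sum_le_sum
      intro i hi
      have a1 := h1 i hi
      have a2 := h2 i hi
      rw [← sq_abs]
      nlinarith
    rw [Finset.sum_sub_distrib, ← Finset.mul_sum, Finset.sum_const, nsmul_eq_mul] at this
    rcases hc with hc | hc
    · rw [hc] at this; exact this
    · subst hc; simpa using this
  apply Real.sqrt_le_iff.2
  have hq : 0 < Real.sqrt s := Real.sqrt_pos.2 hs0
  constructor
  · have : 0 ≤ M - m := by linarith
    positivity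
  · refine key.trans ?_
    have hqq : Real.sqrt s ^ 2 = s := Real.sq_sqrt hs0.le
    set q := Real.sqrt s
    set t := S / q with ht
    have hSt : S = t * q := by rw [ht]; field_simp
    rw [hSt, ← hqq]
    have : 0 ≤ q ^ 2 * (m * (M - m)) := mul_nonneg (sq_nonneg _) (mul_nonneg hm (by linarith))
    nlinarith [sq_nonneg (t - q * (M + 3 * m) / 4)]

lemma tail {n : ℕ} (h : Fin n → ℝ) (s : ℕ) (hs : 1 ≤ s) (F : Finset (Fin n) → ℝ) (c : ℝ) (hc0 : 0 ≤ c)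
    (hF0 : F ∅ ≤ 0)
    (hadd : ∀ P Q, Disjoint P Q → F (P ∪ Q) ≤ F P + F Q) (N : ℕ) :
    ∀ (R : Finset (Fin n)) (M : ℝ), R.card ≤ N → 0 ≤ M → (∀ i ∈ R, |h i| ≤ M) →
    (∀ Q ⊆ R, Q.card ≤ s → F Q ≤ c * Real.sqrt (∑ i ∈ Q, h i ^ 2)) →
    F R ≤ c * ((∑ i ∈ R, |h i|) / Real.sqrt s + Real.sqrt s / 4 * M) := by
  induction N with
  | zero =>
    intro R M hR hM _ _
    have : R = ∅ := by simpa using hR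
    subst this
    refine hF0.trans ?_
    simp only [Finset.sum_empty, zero_div, zero_add]
    positivity
  | succ N ih =>
    intro R M hR hM hb hblk
    rcases R.eq_empty_or_nonempty with rfl | hne
    · refine hF0.trans ?_
      simp only [Finset.sum_empty, zero_div, zero_add]
      positivity
    obtain ⟨Q, hQ, hQc, m, hm, h1, h2, h3⟩ := exists_top h R s
    have hQne : Q.Nonempty := by
      rcases h3 with h3 | ⟨h3, _⟩
      · exact Finset.card_pos.1 (by omega)
      · rw [h3]; exact hne
    obtain ⟨i0, hi0⟩ := hQne
    have hmM : m ≤ M := (h2 i0 hi0).trans (hb i0 (hQ hi0))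
    have hB := block h Q s hs M m hm hmM h2 (fun i hi => hb i (hQ hi)) (h3.imp id (fun x => x.2))
    have hcard : (R \ Q).card ≤ N := by
      have : 0 < Q.card := Finset.card_pos.2 ⟨i0, hi0⟩
      rw [Finset.card_sdiff_of_subset hQ]; omega
    have hI := ih (R \ Q) m hcard hm h1 (fun P hP => hblk P (hP.trans Finset.sdiff_subset))
    have hU : Q ∪ (R \ Q) = R := Finset.union_sdiff_of_subset hQ
    have hA := hadd Q (R \ Q) Finset.disjoint_sdiff
    rw [hU] at hA
    have hBk := hblk Q hQ hQc
    have hsum : ∑ i ∈ R, |h i| = ∑ i ∈ Q, |h i| + ∑ i ∈ R \ Q, |h i| := by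
      rw [add_comm, Finset.sum_sdiff hQ]
    have hB' := mul_le_mul_of_nonneg_left hB hc0
    rw [hsum, add_div]
    nlinarith

/-- restriction of a vector to an index set -/
def res {n : ℕ} (h : Fin n → ℝ) (S : Finset (Fin n)) : Fin n → ℝ := fun i => if i ∈ S then h i else 0

lemma res_union {n : ℕ} (h : Fin n → ℝ) (P Q : Finset (Fin n)) (hd : Disjoint P Q) :
    res h (P ∪ Q) = res h P + res h Q := by
  ext i
  have : i ∈ P → i ∉ Q := fun h => Finset.disjoint_left.1 hd h
  by_cases h1 : i ∈ P <;> by_cases h2 : i ∈ Q <;> simp_all [res]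

lemma res_sq {n : ℕ} (h : Fin n → ℝ) (S : Finset (Fin n)) :
    ∑ i, res h S i ^ 2 = ∑ i ∈ S, h i ^ 2 := by
  simp [res, ite_pow]

lemma l2_eq {n : ℕ} (x : Fin n → ℝ) : l2norm x = ‖WithLp.toLp 2 x‖ := by
  simp [l2norm, EuclideanSpace.norm_eq]

lemma l2_add {n : ℕ} (x y : Fin n → ℝ) : l2norm (x + y) ≤ l2norm x + l2norm y := by
  simp only [l2_eq, WithLp.toLp_add]; exact norm_add_le _ _

lemma l2_sub {n : ℕ} (x y : Fin n → ℝ) : l2norm (x - y) ≤ l2norm x + l2norm y := by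
  simp only [l2_eq, WithLp.toLp_sub]; exact norm_sub_le _ _

lemma l2_sq {n : ℕ} (x : Fin n → ℝ) : l2norm x ^ 2 = ∑ i, x i ^ 2 :=
  Real.sq_sqrt (Finset.sum_nonneg (fun i _ => sq_nonneg _))

lemma l2_nonneg {n : ℕ} (x : Fin n → ℝ) : 0 ≤ l2norm x := Real.sqrt_nonneg _

lemma l2_zero {n : ℕ} (x : Fin n → ℝ) (h : l2norm x = 0) : x = 0 := by
  rw [l2_eq] at h; simpa using h

lemma dot_le {n : ℕ} (x y : Fin n → ℝ) : x ⬝ᵥ y ≤ l2norm x * l2norm y :=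
  Real.sum_mul_le_sqrt_mul_sqrt _ _ _

lemma dot_self' {n : ℕ} (x : Fin n → ℝ) : x ⬝ᵥ x = l2norm x ^ 2 := by
  rw [l2_sq]; simp [dotProduct, sq]

lemma inner_bound {m n : ℕ} (A : Matrix (Fin m) (Fin n) ℝ) (K : ℕ) (δl δu δ : ℝ)
    (hR : RIP A K δl δu) (hl : δl ≤ δ) (hu : δu ≤ δ) (h : Fin n → ℝ) (P Q : Finset (Fin n))
    (hd : Disjoint P Q) (hc : P.card + Q.card ≤ K) :
    |A.mulVec (res h P) ⬝ᵥ A.mulVec (res h Q)| ≤ δ * l2norm (res h P) * l2norm (res h Q) := by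
  set u := res h P with hu'
  set v := res h Q with hv'
  set b := l2norm v with hb
  set c := l2norm u with hcc
  have hb0 : 0 ≤ b := l2_nonneg _
  have hc0 : 0 ≤ c := l2_nonneg _
  rcases hb0.eq_or_lt with hb1 | hb1
  · have : v = 0 := l2_zero v hb1.symm
    rw [this, ← hb1]; simp
  rcases hc0.eq_or_lt with hc1 | hc1
  · have : u = 0 := l2_zero u hc1.symm
    rw [this, ← hc1]; simp
  have huv : ∀ i, u i * v i = 0 := by
    intro i
    have : i ∈ P → i ∉ Q := fun h => Finset.disjoint_left.1 hd h
    by_cases h1 : i ∈ P <;> by_cases h2 : i ∈ Q <;> simp_all [res]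
  have main : ∀ t : ℝ, t ^ 2 = c ^ 2 →
      (1 - δ) * (2 * b ^ 2 * c ^ 2) ≤ b ^ 2 * l2norm (A.mulVec u) ^ 2 + c ^ 2 * l2norm (A.mulVec v) ^ 2
          + 2 * b * t * (A.mulVec u ⬝ᵥ A.mulVec v) ∧
       b ^ 2 * l2norm (A.mulVec u) ^ 2 + c ^ 2 * l2norm (A.mulVec v) ^ 2
          + 2 * b * t * (A.mulVec u ⬝ᵥ A.mulVec v) ≤ (1 + δ) * (2 * b ^ 2 * c ^ 2) := by
    intro t ht
    have hsp : Sparse K (b • u + t • v) := by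
      refine ⟨P ∪ Q, (Finset.card_union_le _ _).trans hc, ?_⟩
      intro i hi
      simp only [Finset.mem_union, not_or] at hi
      simp [hu', hv', res, hi.1, hi.2]
    have hz := hR _ hsp
    have e1 : ∑ i, (b • u + t • v) i ^ 2 = 2 * b ^ 2 * c ^ 2 := by
      have : ∀ i, (b • u + t • v) i ^ 2 = b ^ 2 * u i ^ 2 + t ^ 2 * v i ^ 2 := by
        intro i
        simp only [Pi.add_apply, Pi.smul_apply, smul_eq_mul]
        linear_combination (2 * b * t) * huv i
      simp only [this]
      rw [Finset.sum_add_distrib, ← Finset.mul_sum, ← Finset.mul_sum, ← l2_sq, ← l2_sq, ht]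
      ring
    have e2 : ∑ i, A.mulVec (b • u + t • v) i ^ 2 =
        b ^ 2 * l2norm (A.mulVec u) ^ 2 + c ^ 2 * l2norm (A.mulVec v) ^ 2
          + 2 * b * t * (A.mulVec u ⬝ᵥ A.mulVec v) := by
      rw [← l2_sq, ← dot_self', ← dot_self' (A.mulVec u), ← dot_self' (A.mulVec v), Matrix.mulVec_add, Matrix.mulVec_smul,
        Matrix.mulVec_smul, ← ht]
      simp only [dotProduct_add, add_dotProduct, smul_dotProduct, dotProduct_smul, smul_eq_mul]
      rw [dotProduct_comm (A.mulVec v) (A.mulVec u)]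
      ring
    rw [e1, e2] at hz
    have hpos : 0 ≤ 2 * b ^ 2 * c ^ 2 := by positivity
    constructor
    · refine le_trans ?_ hz.1
      exact mul_le_mul_of_nonneg_right (by linarith) hpos
    · refine hz.2.trans ?_
      exact mul_le_mul_of_nonneg_right (by linarith) hpos
  have m1 := main c rfl
  have m2 := main (-c) (by ring)
  have hbc : 0 < b * c := mul_pos hb1 hc1
  rw [abs_le]
  constructor
  · refine le_of_mul_le_mul_left ?_ hbc
    nlinarith [m1.1, m2.2]
  · refine le_of_mul_le_mul_left ?_ hbc
    nlinarith [m1.2, m2.1]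

lemma le_sq {a b : ℝ} (h : a ^ 2 ≤ b ^ 2) (hb : 0 ≤ b) : a ≤ b :=
  (abs_le_of_sq_le_sq' h hb).2

end TailL1

set_option maxHeartbeats 2000000 in
theorem stmt1 {m n : ℕ} (A : Matrix (Fin m) (Fin n) ℝ)
    (T : Finset (Fin n)) (kT : ℕ) (hkT : T.card = kT)
    (k : ℕ) (hk : 1 ≤ k) (a : ℝ) (ha : 0 < a)
    (K : ℝ) (hK : K = max ((a + 1) * k + kT) (2 * a * k))
    (δl δu : ℝ) (hδl0 : 0 < δl) (hδl1 : δl < 1) (hδu0 : 0 < δu)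
    (hRIP : RIP A (Nat.ceil K) δl δu)
    (δ : ℝ) (hδ : δ = max δl δu)
    (ha2 : a > 2 * δ ^ 2 / (1 - δl) ^ 2)
    (ε : ℝ) (x : Fin n → ℝ) (w : Fin m → ℝ) (hw : l2norm w ≤ ε)
    (y : Fin m → ℝ) (hy : y = A.mulVec x + w)
    -- `S₀ ⊆ Tᶜ` is a set of `k` indices of the largest-magnitude entries of `x` on `Tᶜ`
    (S0 : Finset (Fin n)) (hS0T : S0 ⊆ Tᶜ) (hS0card : S0.card = k)
    (hS0max : ∀ i ∈ S0, ∀ j ∈ Tᶜ \ S0, |x j| ≤ |x i|)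
    -- `zhat` is a solution of the tail-ℓ₁ minimization problem
    (zhat : Fin n → ℝ)
    (hfeas : l2norm (A.mulVec zhat - y) ≤ ε)
    (hopt : ∀ z : Fin n → ℝ, l2norm (A.mulVec z - y) ≤ ε →
      l1normOn Tᶜ zhat ≤ l1normOn Tᶜ z) :
    l2norm (zhat - x) ≤
      2 * (Real.sqrt a + 1) * Real.sqrt (1 + δ)
          / (Real.sqrt a * (1 - δl) - Real.sqrt 2 * δ) * ε
        + (2 * Real.sqrt 2 * (Real.sqrt a + 1) * δ
            / (Real.sqrt a * (1 - δl) - Real.sqrt 2 * δ) + 2)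
          * (l1normOn (Tᶜ \ S0) x / Real.sqrt (a * k)) := by
  classical
  subst hkT
  have hδl : δl ≤ δ := by rw [hδ]; exact le_max_left _ _
  have hδu : δu ≤ δ := by rw [hδ]; exact le_max_right _ _
  have hδ0 : 0 < δ := hδl0.trans_le hδl
  have hk0 : (0:ℝ) < k := by exact_mod_cast hk
  have hak : 0 < a * k := mul_pos ha hk0
  have hε : 0 ≤ ε := (TailL1.l2_nonneg w).trans hw
  -- block sizes
  set s := Nat.ceil (a * k) with hs
  have hs1 : 1 ≤ s := Nat.ceil_pos.2 hak
  have hsak : a * k ≤ s := Nat.le_ceil _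
  have hK1 : s + (k + T.card) ≤ Nat.ceil K := by
    have : (a + 1) * k + (T.card : ℝ) = a * k + ((k + T.card : ℕ) : ℝ) := by push_cast; ring
    have h2 : Nat.ceil (a * k + ((k + T.card : ℕ) : ℝ)) ≤ Nat.ceil K := by
      apply Nat.ceil_mono
      rw [← this, hK]; exact le_max_left _ _
    rwa [Nat.ceil_add_natCast hak.le] at h2
  have hK2 : 2 * s - 1 ≤ Nat.ceil K := by
    have h1 : (s : ℝ) < a * k + 1 := Nat.ceil_lt_add_one hak.le
    have h2 : 2 * a * k ≤ Nat.ceil K := by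
      refine le_trans ?_ (Nat.le_ceil K)
      rw [hK]; exact le_max_right _ _
    have h3 : (2 * s : ℝ) < Nat.ceil K + 2 := by linarith
    have h4 : 2 * s < Nat.ceil K + 2 := by exact_mod_cast h3
    omega
  obtain ⟨s1, hs1s, hs1K, hs14⟩ : ∃ s1 : ℕ, s1 ≤ s ∧ s1 + s ≤ Nat.ceil K ∧ s ≤ 4 * s1 := by
    rcases hs1.eq_or_lt with h | h
    · exact ⟨1, by omega, by omega, by omega⟩
    · exact ⟨s - 1, by omega, by omega, by omega⟩
  set h := zhat - x with hh
  set R0 := Tᶜ \ S0 with hR0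
  obtain ⟨S1, hS1, hS1c, M, hM, hM1, hM2, hM3⟩ := TailL1.exists_top h R0 s1
  set R := R0 \ S1 with hR
  set P := T ∪ S0 with hP
  have hPc : P.card ≤ k + T.card := by
    have := Finset.card_union_le T S0
    rw [← hP] at this; omega
  have hPR0 : Disjoint P R0 := by
    rw [Finset.disjoint_left]
    intro i hi
    simp only [hP, hR0, Finset.mem_union, Finset.mem_sdiff, Finset.mem_compl] at hi ⊢
    tauto
  have hPS1 : Disjoint P S1 := hPR0.mono_right hS1
  have hPR : Disjoint P R := hPR0.mono_right Finset.sdiff_subset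
  have hS1R : Disjoint S1 R := Finset.disjoint_sdiff
  have hall : (P ∪ S1) ∪ R = Finset.univ := by
    ext i
    simp only [hP, hR, hR0, Finset.mem_union, Finset.mem_sdiff, Finset.mem_compl, Finset.mem_univ,
      iff_true]
    tauto
  have hPSR : Disjoint (P ∪ S1) R := Finset.disjoint_union_left.2 ⟨hPR, hS1R⟩
  set G : Finset (Fin n) → (Fin m → ℝ) := fun S => A.mulVec (TailL1.res h S) with hG
  have hGadd : ∀ S S', Disjoint S S' → G (S ∪ S') = G S + G S' := by
    intro S S' hd
    simp only [hG, TailL1.res_union h S S' hd, Matrix.mulVec_add]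
  have hres : TailL1.res h ∅ = 0 := by ext i; simp [TailL1.res]
  have hGe : G ∅ = 0 := by simp [hG, hres]
  set N : Finset (Fin n) → ℝ := fun S => l2norm (TailL1.res h S) with hN
  have hN' : ∀ S, N S = Real.sqrt (∑ i ∈ S, h i ^ 2) := by
    intro S; simp only [hN, l2norm, TailL1.res_sq]
  set tl := ∑ i ∈ R0, |h i| with htl
  have hq : 0 < Real.sqrt s := Real.sqrt_pos.2 (by exact_mod_cast hs1)
  set B := (∑ i ∈ R, |h i|) / Real.sqrt s + Real.sqrt s / 4 * M with hB
  -- tail bounds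
  have hcross : ∀ U : Finset (Fin n), Disjoint U R → U.card + s ≤ Nat.ceil K →
      |G U ⬝ᵥ G R| ≤ δ * N U * B := by
    intro U hU hUc
    refine TailL1.tail h s hs1 (fun S => |G U ⬝ᵥ G S|) (δ * N U)
      (mul_nonneg hδ0.le (TailL1.l2_nonneg _)) ?_ ?_ R.card R M le_rfl hM hM1 ?_
    · simp [hGe]
    · intro S S' hd
      simp only [hGadd S S' hd, dotProduct_add]
      exact abs_add_le _ _
    · intro Q hQ hQc
      have := TailL1.inner_bound A _ δl δu δ hRIP hδl hδu h U Q (hU.mono_right hQ) (by omega)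
      rw [← hN']; exact this
  have hNR : N R ≤ B := by
    have := TailL1.tail h s hs1 N 1 zero_le_one ?_ ?_ R.card R M le_rfl hM hM1 ?_
    · simpa using this
    · simp [hN, hres, l2norm]
    · intro S S' hd
      simp only [hN, TailL1.res_union h S S' hd]
      exact TailL1.l2_add _ _
    · intro Q _ _
      rw [hN', one_mul]
  have hBtl : B ≤ tl / Real.sqrt s := by
    have e : tl = ∑ i ∈ S1, |h i| + ∑ i ∈ R, |h i| := by
      rw [htl, add_comm, hR, Finset.sum_sdiff hS1]
    have e2 : (s:ℝ) / 4 * M ≤ ∑ i ∈ S1, |h i| := by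
      rcases hM3 with h3 | ⟨_, h3⟩
      · have : (s1 : ℝ) * M ≤ ∑ i ∈ S1, |h i| := by
          rw [← h3, ← nsmul_eq_mul]
          exact Finset.card_nsmul_le_sum _ _ _ hM2
        have h4 : (s : ℝ) ≤ 4 * s1 := by exact_mod_cast hs14
        nlinarith
      · rw [h3, mul_zero]; exact Finset.sum_nonneg (fun i _ => abs_nonneg _)
    have e3 : Real.sqrt s / 4 * M = ((s:ℝ) / 4 * M) / Real.sqrt s := by
      have : Real.sqrt s * Real.sqrt s = s := Real.mul_self_sqrt (by positivity)
      field_simp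
      rw [sq, this, mul_comm]
    rw [hB, e3, ← add_div, e]
    exact div_le_div_of_nonneg_right (by linarith) hq.le
  -- optimality: cone constraint
  set σ := l1normOn R0 x with hσ
  have hσ0 : 0 ≤ σ := Finset.sum_nonneg (fun i _ => abs_nonneg _)
  have hAx : l2norm (A.mulVec x - y) ≤ ε := by
    have : A.mulVec x - y = 0 - w := by rw [hy]; abel
    rw [this]
    refine (TailL1.l2_sub 0 w).trans ?_
    simpa [l2norm] using hw
  have hcone : tl ≤ ∑ i ∈ S0, |h i| + 2 * σ := by
    have ho := hopt x hAx
    simp only [l1normOn] at ho hσ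
    rw [← Finset.sum_sdiff hS0T, ← Finset.sum_sdiff (f := fun i => |x i|) hS0T] at ho
    have e1 : ∑ i ∈ S0, |x i| ≤ ∑ i ∈ S0, |zhat i| + ∑ i ∈ S0, |h i| := by
      rw [← Finset.sum_add_distrib]
      apply Finset.sum_le_sum
      intro i _
      have : x i = zhat i - h i := by simp [hh]
      rw [this]; exact abs_sub _ _
    have e2 : tl ≤ ∑ i ∈ R0, |zhat i| + ∑ i ∈ R0, |x i| := by
      rw [htl, ← Finset.sum_add_distrib]
      apply Finset.sum_le_sum
      intro i _
      simp only [hh, Pi.sub_apply]; exact abs_sub _ _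
    rw [← hR0] at ho
    linarith
  have hAh : l2norm (A.mulVec h) ≤ 2 * ε := by
    have : A.mulVec h = (A.mulVec zhat - y) - (A.mulVec x - y) := by
      rw [hh, Matrix.mulVec_sub]; abel
    rw [this]
    refine (TailL1.l2_sub _ _).trans ?_
    linarith
  have hp0 : 0 ≤ N P := TailL1.l2_nonneg _
  have hq0 : 0 ≤ N S1 := TailL1.l2_nonneg _
  have hr0 : 0 ≤ N (P ∪ S1) := TailL1.l2_nonneg _
  have hsa : 0 < Real.sqrt a := Real.sqrt_pos.2 ha
  have hsk : 0 < Real.sqrt k := Real.sqrt_pos.2 hk0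
  have hsak' : Real.sqrt (a * k) = Real.sqrt a * Real.sqrt k := Real.sqrt_mul ha.le _
  have hS0l1 : ∑ i ∈ S0, |h i| ≤ Real.sqrt k * N P := by
    have e1 : ∑ i ∈ S0, 1 * |h i| ≤ Real.sqrt (∑ i ∈ S0, (1:ℝ) ^ 2) * Real.sqrt (∑ i ∈ S0, |h i| ^ 2) :=
      Real.sum_mul_le_sqrt_mul_sqrt _ _ _
    simp only [one_mul, one_pow, Finset.sum_const, nsmul_eq_mul, mul_one, hS0card, sq_abs] at e1
    refine e1.trans ?_
    rw [hN']
    gcongr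
    exact Finset.subset_union_right
  have hpqr : N (P ∪ S1) ^ 2 = N P ^ 2 + N S1 ^ 2 := by
    simp only [hN, TailL1.l2_sq, TailL1.res_sq]
    exact Finset.sum_union hPS1
  set p := N P
  set q := N S1
  set r := N (P ∪ S1) with hr
  set X := σ / Real.sqrt (a * k) with hX
  have hX0 : 0 ≤ X := by positivity
  have hpr : p ≤ r := by
    refine TailL1.le_sq ?_ hr0
    linarith [sq_nonneg q]
  have hBX : B ≤ r / Real.sqrt a + 2 * X := by
    have e0 : 0 ≤ tl := Finset.sum_nonneg (fun i _ => abs_nonneg _)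
    have e1 : tl / Real.sqrt s ≤ tl / Real.sqrt (a * k) := by
      gcongr
    have e2 : tl / Real.sqrt (a * k) ≤ (Real.sqrt k * r + 2 * σ) / Real.sqrt (a * k) := by
      gcongr
      have := mul_le_mul_of_nonneg_left hpr hsk.le
      linarith
    have e3 : (Real.sqrt k * r + 2 * σ) / Real.sqrt (a * k) = r / Real.sqrt a + 2 * X := by
      rw [hX, hsak']
      field_simp
    linarith
  have hB0 : 0 ≤ B := (TailL1.l2_nonneg _).trans hNR
  have hpq : p + q ≤ Real.sqrt 2 * r := by
    refine TailL1.le_sq ?_ (by positivity)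
    rw [mul_pow, Real.sq_sqrt (by norm_num), hpqr]
    linarith [sq_nonneg (p - q), add_sq p q, sub_sq p q]
  have hsp : Sparse (Nat.ceil K) (TailL1.res h (P ∪ S1)) := by
    refine ⟨P ∪ S1, ?_, fun i hi => by simp [TailL1.res, hi]⟩
    have := Finset.card_union_le P S1
    omega
  have hrip := hRIP _ hsp
  rw [← TailL1.l2_sq, ← TailL1.l2_sq] at hrip
  have hrip1 : (1 - δl) * r ^ 2 ≤ l2norm (G (P ∪ S1)) ^ 2 := hrip.1
  have hrip2 : l2norm (G (P ∪ S1)) ≤ Real.sqrt (1 + δ) * r := by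
    refine TailL1.le_sq ?_ (by positivity)
    rw [mul_pow, Real.sq_sqrt (by linarith)]
    refine le_trans hrip.2 ?_
    exact mul_le_mul_of_nonneg_right (by linarith) (sq_nonneg _)
  have hGh : A.mulVec h = G (P ∪ S1) + G R := by
    rw [← hGadd _ _ hPSR, hall]
    simp only [hG]; congr 1; ext i; simp [TailL1.res]
  have hmain : (1 - δl) * r ^ 2 ≤ (2 * Real.sqrt (1 + δ) * ε) * r + Real.sqrt 2 * δ * r * B := by
    have e1 : l2norm (G (P ∪ S1)) ^ 2 = G (P ∪ S1) ⬝ᵥ A.mulVec h - G (P ∪ S1) ⬝ᵥ G R := by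
      rw [hGh, dotProduct_add, ← TailL1.dot_self']; ring
    have e2 : G (P ∪ S1) ⬝ᵥ A.mulVec h ≤ (Real.sqrt (1 + δ) * r) * (2 * ε) := by
      refine (TailL1.dot_le _ _).trans ?_
      exact mul_le_mul hrip2 hAh (TailL1.l2_nonneg _) (by positivity)
    have e3 : G (P ∪ S1) ⬝ᵥ G R = G P ⬝ᵥ G R + G S1 ⬝ᵥ G R := by
      rw [hGadd _ _ hPS1, add_dotProduct]
    have e4 := (abs_le.1 (hcross P hPR (by omega))).1
    have e5 := (abs_le.1 (hcross S1 hS1R (by omega))).1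
    have e6 : δ * B * (p + q) ≤ δ * B * (Real.sqrt 2 * r) :=
      mul_le_mul_of_nonneg_left hpq (by positivity)
    linarith
  have hD : 0 < Real.sqrt a * (1 - δl) - Real.sqrt 2 * δ := by
    have h1 : 0 < 1 - δl := by linarith
    rw [gt_iff_lt, div_lt_iff₀ (by positivity)] at ha2
    have : Real.sqrt 2 * δ < Real.sqrt a * (1 - δl) := by
      apply lt_of_pow_lt_pow_left₀ 2 (by positivity)
      rw [mul_pow, mul_pow, Real.sq_sqrt (by norm_num), Real.sq_sqrt ha.le]
      exact ha2
    linarith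
  set D := Real.sqrt a * (1 - δl) - Real.sqrt 2 * δ with hDdef
  have hrD : r * D ≤ Real.sqrt a * (2 * Real.sqrt (1 + δ) * ε + 2 * Real.sqrt 2 * δ * X) := by
    rcases hr0.eq_or_lt with h0 | h0
    · rw [← h0, zero_mul]; positivity
    · have e1 : (1 - δl) * r ≤ 2 * Real.sqrt (1 + δ) * ε + Real.sqrt 2 * δ * B := by
        refine le_of_mul_le_mul_right ?_ h0
        linarith
      have e2 : Real.sqrt 2 * δ * B ≤ Real.sqrt 2 * δ * (r / Real.sqrt a + 2 * X) :=
        mul_le_mul_of_nonneg_left hBX (by positivity)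
      have e3 := mul_le_mul_of_nonneg_left (e1.trans (add_le_add_right e2 _)) hsa.le
      have e4 : Real.sqrt a * (r / Real.sqrt a) = r := by field_simp
      have e5 : Real.sqrt a * (2 * Real.sqrt (1 + δ) * ε + Real.sqrt 2 * δ * (r / Real.sqrt a + 2 * X))
        = Real.sqrt a * (2 * Real.sqrt (1 + δ) * ε + 2 * Real.sqrt 2 * δ * X) + Real.sqrt 2 * δ * r := by
        linear_combination (Real.sqrt 2 * δ) * e4
      rw [e5] at e3
      rw [hDdef]
      linarith
  have hfin : l2norm h ≤ r + B := by
    have : h = TailL1.res h (P ∪ S1) + TailL1.res h R := by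
      rw [← TailL1.res_union _ _ _ hPSR, hall]; ext i; simp [TailL1.res]
    have e := TailL1.l2_add (TailL1.res h (P ∪ S1)) (TailL1.res h R)
    rw [← this] at e
    exact e.trans (add_le_add_right hNR _)
  have hrD' : r / Real.sqrt a ≤ (2 * Real.sqrt (1 + δ) * ε + 2 * Real.sqrt 2 * δ * X) / D := by
    rw [div_le_div_iff₀ hsa hD]
    linarith
  have hlast : r + r / Real.sqrt a = (Real.sqrt a + 1) * (r / Real.sqrt a) := by
    field_simp
  have := mul_le_mul_of_nonneg_left hrD' (by positivity : 0 ≤ Real.sqrt a + 1)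
  calc l2norm h ≤ (Real.sqrt a + 1) * (r / Real.sqrt a) + 2 * X := by linarith
    _ ≤ (Real.sqrt a + 1) * ((2 * Real.sqrt (1 + δ) * ε + 2 * Real.sqrt 2 * δ * X) / D) + 2 * X := by
        linarith
    _ = _ := by ring
end

section
/- Let T ⊆ {1,…,n} with |T| = k_T, let k ≥ 1 be an integer, let a > 0, and set K = max{(a+1)k + k_T, 2ak}. Suppose A ∈ ℝ^{m×n} satisfies the order-K RIP with constants 0 < δ_{K,l} < 1 and δ_{K,u} > 0, and that a > 2δ_K²/(1−δ_{K,l})², where δ_K = max{δ_{K,l}, δ_{K,u}}. If x ∈ ℝⁿ has at most k nonzero entries and y = Ax (no noise), then any solution ẑ of the tail-ℓ₁ minimization problem with ε = 0, i.e. of min_{z ∈ ℝⁿ} ‖z_{T^c}‖₁ subject to Az = y, satisfies ẑ = x. -/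
open scoped BigOperators

lemma topset {n : ℕ} (b : Fin n → ℝ) (hb : ∀ i, 0 ≤ b i) (U : Finset (Fin n)) (s : ℕ)
    (hs : s ≤ U.card) : ∃ W ⊆ U, W.card = s ∧ ∃ M : ℝ, 0 ≤ M ∧ (∀ i ∈ U \ W, b i ≤ M) ∧
      ∀ i ∈ W, M ≤ b i := by
  induction s with
  | zero =>
    refine ⟨∅, by simp, by simp, ∑ i ∈ U, b i, Finset.sum_nonneg (fun i _ => hb i), ?_, by simp⟩
    intro i hi
    exact Finset.single_le_sum (f := b) (fun i _ => hb i) (by simpa using hi)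
  | succ s ih =>
    obtain ⟨W, hWU, hc, M, hM, h1, h2⟩ := ih (by omega)
    have hne : (U \ W).Nonempty := by
      rw [← Finset.card_pos, Finset.card_sdiff_of_subset hWU]; omega
    obtain ⟨j, hj, hmax⟩ := Finset.exists_max_image (U \ W) b hne
    have hj' := Finset.mem_sdiff.1 hj
    refine ⟨insert j W, ?_, ?_, b j, hb j, ?_, ?_⟩
    · intro i hi
      rcases Finset.mem_insert.1 hi with rfl | h
      · exact hj'.1
      · exact hWU h
    · rw [Finset.card_insert_of_notMem hj'.2, hc]
    · intro i hi
      apply hmax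
      simp only [Finset.mem_sdiff, Finset.mem_insert, not_or] at hi ⊢
      exact ⟨hi.1, hi.2.2⟩
    · intro i hi
      rcases Finset.mem_insert.1 hi with rfl | h
      · exact le_rfl
      · exact (h1 j hj).trans (h2 i h)

lemma topset2 {n : ℕ} (b : Fin n → ℝ) (hb : ∀ i, 0 ≤ b i) (U : Finset (Fin n)) (s : ℕ) :
    ∃ W ⊆ U, W.card = min s U.card ∧ ∃ M : ℝ, 0 ≤ M ∧ (∀ i ∈ U \ W, b i ≤ M) ∧
      s * M ≤ ∑ i ∈ W, b i := by
  rcases le_total s U.card with h | h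
  · obtain ⟨W, h1, h2, M, h3, h4, h5⟩ := topset b hb U s h
    refine ⟨W, h1, by omega, M, h3, h4, ?_⟩
    have := Finset.card_nsmul_le_sum W b M h5
    rwa [h2, nsmul_eq_mul] at this
  · refine ⟨U, subset_rfl, by omega, 0, le_rfl, by simp, ?_⟩
    simpa using Finset.sum_nonneg (fun i _ => hb i)

lemma blocks {n : ℕ} (h f : Fin n → ℝ) (s : ℕ) (hs : 1 ≤ s) (C : ℝ) (hC : 0 ≤ C)
    (c : ℕ) : ∀ (U : Finset (Fin n)), U.card ≤ c → ∀ M : ℝ, 0 ≤ M → (∀ i ∈ U, |h i| ≤ M) →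
    (∀ W ⊆ U, W.card ≤ s → |∑ i ∈ W, f i| ≤ C * √(∑ i ∈ W, h i ^ 2)) →
    |∑ i ∈ U, f i| ≤ C * (√s * M + (∑ i ∈ U, |h i|) / √s) := by
  have hsp : (0:ℝ) < √s := Real.sqrt_pos.2 (by exact_mod_cast hs)
  have hss : √(s:ℝ) * √s = s := Real.mul_self_sqrt (by positivity)
  induction c with
  | zero =>
    intro U hU M hM _ _
    have : U = ∅ := by simpa using hU
    subst this
    simp; positivity
  | succ c ih =>
    intro U hU M hM hb hf
    rcases U.eq_empty_or_nonempty with rfl | hne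
    · simp; positivity
    obtain ⟨W, hWU, hc, M', hM', h1, h2⟩ := topset2 (fun i => |h i|) (fun i => abs_nonneg _) U s
    have hpos := hne.card_pos
    have hI := ih (U \ W) (by rw [Finset.card_sdiff_of_subset hWU]; omega) M' hM' h1
      (fun V hV => hf V (hV.trans Finset.sdiff_subset))
    have hW := hf W hWU (by omega)
    have hW2 : √(∑ i ∈ W, h i ^ 2) ≤ √s * M := by
      apply Real.sqrt_le_iff.2 ⟨by positivity, ?_⟩
      have : ∑ i ∈ W, h i ^ 2 ≤ W.card • M ^ 2 := by
        apply Finset.sum_le_card_nsmul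
        intro i hi
        rw [← sq_abs]
        exact pow_le_pow_left₀ (abs_nonneg _) (hb i (hWU hi)) 2
      rw [nsmul_eq_mul] at this
      have hcs : (W.card : ℝ) ≤ s := by exact_mod_cast (by omega : W.card ≤ s)
      calc _ ≤ _ := this
        _ ≤ s * M^2 := by gcongr
        _ = _ := by rw [mul_pow, Real.sq_sqrt (by positivity)]
    have hM2 : √s * M' ≤ (∑ i ∈ W, |h i|) / √s := by
      rw [le_div_iff₀ hsp]; nlinarith
    rw [← Finset.sum_sdiff hWU, ← Finset.sum_sdiff (f := fun i => |h i|) hWU]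
    calc _ ≤ |∑ i ∈ U \ W, f i| + |∑ i ∈ W, f i| := abs_add_le _ _
      _ ≤ C * (√s * M' + (∑ i ∈ U \ W, |h i|) / √s) + C * (√s * M) :=
        add_le_add hI (hW.trans (mul_le_mul_of_nonneg_left hW2 hC))
      _ ≤ C * ((∑ i ∈ W, |h i|) / √s + (∑ i ∈ U \ W, |h i|) / √s) + C * (√s * M) := by gcongr
      _ = _ := by rw [add_div]; ring

lemma rip_comb {m n : ℕ} (A : Matrix (Fin m) (Fin n) ℝ) (N : ℕ) (δl δu : ℝ)
    (hR : RIP A N δl δu) (h : Fin n → ℝ) (W V : Finset (Fin n)) (hd : Disjoint W V)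
    (hc : W.card + V.card ≤ N) (α β : ℝ) :
    (1 - δl) * (α ^ 2 * ∑ i ∈ W, h i ^ 2 + β ^ 2 * ∑ i ∈ V, h i ^ 2) ≤
      ∑ r, (α * ∑ i ∈ W, A r i * h i + β * ∑ i ∈ V, A r i * h i) ^ 2 ∧
    ∑ r, (α * ∑ i ∈ W, A r i * h i + β * ∑ i ∈ V, A r i * h i) ^ 2 ≤
      (1 + δu) * (α ^ 2 * ∑ i ∈ W, h i ^ 2 + β ^ 2 * ∑ i ∈ V, h i ^ 2) := by
  classical
  have key := hR (fun i => (if i ∈ W then α * h i else 0) + (if i ∈ V then β * h i else 0))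
    ⟨W ∪ V, (Finset.card_union_le _ _).trans hc, fun i hi => by
      simp only [Finset.mem_union, not_or] at hi; simp [hi.1, hi.2]⟩
  have e1 : ∑ i, ((if i ∈ W then α * h i else 0) + (if i ∈ V then β * h i else 0)) ^ 2
      = α ^ 2 * ∑ i ∈ W, h i ^ 2 + β ^ 2 * ∑ i ∈ V, h i ^ 2 := by
    have : ∀ i, ((if i ∈ W then α * h i else 0) + (if i ∈ V then β * h i else 0)) ^ 2
      = (if i ∈ W then α ^ 2 * h i ^ 2 else 0) + (if i ∈ V then β ^ 2 * h i ^ 2 else 0) := by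
      intro i
      by_cases h1 : i ∈ W
      · have h2 : i ∉ V := Finset.disjoint_left.1 hd h1
        simp [h1, h2]; ring
      · by_cases h2 : i ∈ V <;> simp [h1, h2]; ring
    simp only [this, Finset.sum_add_distrib, Finset.sum_ite_mem, Finset.univ_inter, Finset.mul_sum]
  have e2 : ∀ r, A.mulVec (fun i => (if i ∈ W then α * h i else 0) + (if i ∈ V then β * h i else 0)) r
      = α * ∑ i ∈ W, A r i * h i + β * ∑ i ∈ V, A r i * h i := by
    intro r
    simp only [Matrix.mulVec, dotProduct, mul_add, Finset.sum_add_distrib, mul_ite, mul_zero,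
      Finset.sum_ite_mem, Finset.univ_inter, Finset.mul_sum]
    congr 1 <;> exact Finset.sum_congr rfl (fun i _ => by ring)
  simp only [e1, e2] at key
  exact key

lemma rip_inner {m n : ℕ} (A : Matrix (Fin m) (Fin n) ℝ) (N : ℕ) (δl δu δ : ℝ)
    (hl : δl ≤ δ) (hu : δu ≤ δ)
    (hR : RIP A N δl δu) (h : Fin n → ℝ) (W V : Finset (Fin n)) (hd : Disjoint W V)
    (hc : W.card + V.card ≤ N) :
    |∑ r, (∑ i ∈ W, A r i * h i) * (∑ i ∈ V, A r i * h i)| ≤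
      δ * √(∑ i ∈ W, h i ^ 2) * √(∑ i ∈ V, h i ^ 2) := by
  have hP0 : 0 ≤ ∑ i ∈ W, h i ^ 2 := Finset.sum_nonneg (fun i _ => sq_nonneg _)
  have hQ0 : 0 ≤ ∑ i ∈ V, h i ^ 2 := Finset.sum_nonneg (fun i _ => sq_nonneg _)
  have zero : ∀ Z : Finset (Fin n), ∑ i ∈ Z, h i ^ 2 = 0 → ∀ r, ∑ i ∈ Z, A r i * h i = 0 := by
    intro Z hZ r
    rw [Finset.sum_eq_zero_iff_of_nonneg (fun i _ => sq_nonneg _)] at hZ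
    apply Finset.sum_eq_zero
    intro i hi
    have := hZ i hi
    have : h i = 0 := by simpa using this
    simp [this]
  rcases hP0.eq_or_lt with hP | hP
  · simp [zero W hP.symm, ← hP]
  rcases hQ0.eq_or_lt with hQ | hQ
  · simp [zero V hQ.symm, ← hQ]
  set P := √(∑ i ∈ W, h i ^ 2) with hPd
  set Q := √(∑ i ∈ V, h i ^ 2) with hQd
  have hP1 : 0 < P := Real.sqrt_pos.2 hP
  have hQ1 : 0 < Q := Real.sqrt_pos.2 hQ
  have hP2 : ∑ i ∈ W, h i ^ 2 = P ^ 2 := (Real.sq_sqrt hP0).symm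
  have hQ2 : ∑ i ∈ V, h i ^ 2 = Q ^ 2 := (Real.sq_sqrt hQ0).symm
  have k1 := rip_comb A N δl δu hR h W V hd hc Q P
  have k2 := rip_comb A N δl δu hR h W V hd hc Q (-P)
  rw [hP2, hQ2] at k1 k2
  have id : ∑ r, (Q * ∑ i ∈ W, A r i * h i + P * ∑ i ∈ V, A r i * h i) ^ 2
    - ∑ r, (Q * ∑ i ∈ W, A r i * h i + (-P) * ∑ i ∈ V, A r i * h i) ^ 2
    = 4 * (P * Q) * ∑ r, (∑ i ∈ W, A r i * h i) * (∑ i ∈ V, A r i * h i) := by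
    rw [← Finset.sum_sub_distrib, Finset.mul_sum]
    exact Finset.sum_congr rfl (fun i _ => by ring)
  set I := ∑ r, (∑ i ∈ W, A r i * h i) * (∑ i ∈ V, A r i * h i)
  have hPQ : 0 < P * Q := by positivity
  have a1 : (P*Q)*(P*Q) * δl ≤ (P*Q)*(P*Q) * δ := by gcongr
  have a2 : (P*Q)*(P*Q) * δu ≤ (P*Q)*(P*Q) * δ := by gcongr
  rw [abs_le]
  constructor
  · refine le_of_mul_le_mul_left ?_ hPQ
    nlinarith [k1.1, k2.2]
  · refine le_of_mul_le_mul_left ?_ hPQ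
    nlinarith [k2.1, k1.2]

/-- core estimate -/
lemma core {m n : ℕ} (A : Matrix (Fin m) (Fin n) ℝ) (N : ℕ) (δl δu δ : ℝ)
    (hl : δl ≤ δ) (hu : δu ≤ δ) (hδ0 : 0 ≤ δ)
    (hR : RIP A N δl δu) (h : Fin n → ℝ) (hA : ∀ r, ∑ i, A r i * h i = 0)
    (T0 : Finset (Fin n)) (k s : ℕ) (hs : 1 ≤ s) (h1 : T0.card + s ≤ N) (h2 : s + s ≤ N)
    (hcone : ∑ i ∈ T0ᶜ, |h i| ≤ √k * √(∑ i ∈ T0, h i ^ 2)) :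
    ∃ v : ℝ, 0 ≤ v ∧ (1 - δl) * ((∑ i ∈ T0, h i ^ 2) + v ^ 2) ≤
      δ * (√(∑ i ∈ T0, h i ^ 2) + v) * (√k * √(∑ i ∈ T0, h i ^ 2) / √s) := by
  have hsp : (0:ℝ) < √s := Real.sqrt_pos.2 (by exact_mod_cast hs)
  have hss : √(s:ℝ) * √s = s := Real.mul_self_sqrt (by positivity)
  obtain ⟨T1, hT1, hc, M, hM, hb, hMs⟩ := topset2 (fun i => |h i|) (fun i => abs_nonneg _) T0ᶜ s
  have hd : Disjoint T0 T1 := by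
    rw [Finset.disjoint_left]; intro i hi hi'; simpa [hi] using hT1 hi'
  have hv2 : √(∑ i ∈ T1, h i ^ 2) ^ 2 = ∑ i ∈ T1, h i ^ 2 :=
    Real.sq_sqrt (Finset.sum_nonneg (fun i _ => sq_nonneg _))
  refine ⟨√(∑ i ∈ T1, h i ^ 2), Real.sqrt_nonneg _, ?_⟩
  set u := √(∑ i ∈ T0, h i ^ 2)
  set v := √(∑ i ∈ T1, h i ^ 2)
  have hu0 : 0 ≤ u := Real.sqrt_nonneg _
  have hv0 : 0 ≤ v := Real.sqrt_nonneg _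
  have k1 := (rip_comb A N δl δu hR h T0 T1 hd (by omega) 1 1).1
  simp only [one_mul, one_pow] at k1
  rw [hv2]
  refine k1.trans ?_
  set f : Fin n → ℝ := fun i => ∑ r, ((∑ i ∈ T0, A r i * h i) + ∑ i ∈ T1, A r i * h i) * (A r i * h i)
    with hf
  have hfW : ∀ W : Finset (Fin n), ∑ i ∈ W, f i =
     ∑ r, (∑ i ∈ T0, A r i * h i) * (∑ i ∈ W, A r i * h i) +
     ∑ r, (∑ i ∈ T1, A r i * h i) * (∑ i ∈ W, A r i * h i) := by
    intro W
    rw [hf, Finset.sum_comm, ← Finset.sum_add_distrib]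
    refine Finset.sum_congr rfl (fun r _ => ?_)
    rw [← Finset.mul_sum]; ring
  have hB := blocks h f s hs (δ * (u + v)) (by positivity) _ (T0ᶜ \ T1) le_rfl M hM hb (by
    intro W hW hWc
    have d0 : Disjoint T0 W := by
      rw [Finset.disjoint_left]; intro i hi hi'; simpa [hi] using hW hi'
    have d1 : Disjoint T1 W := by
      rw [Finset.disjoint_left]; intro i hi hi'; simpa [hi] using hW hi'
    rw [hfW]
    refine (abs_add_le _ _).trans ?_
    have i1 := rip_inner A N δl δu δ hl hu hR h T0 W d0 (by omega)
    have i2 := rip_inner A N δl δu δ hl hu hR h T1 W d1 (by omega)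
    calc _ ≤ _ := add_le_add i1 i2
      _ = _ := by ring)
  have e : ∑ r, (∑ i ∈ T0, A r i * h i + ∑ i ∈ T1, A r i * h i) ^ 2 = - ∑ i ∈ T0ᶜ \ T1, f i := by
    rw [hfW, ← Finset.sum_add_distrib, ← Finset.sum_neg_distrib]
    refine Finset.sum_congr rfl (fun r _ => ?_)
    have := hA r
    rw [← Finset.sum_add_sum_compl T0, ← Finset.sum_sdiff hT1] at this
    have : ∑ i ∈ T0ᶜ \ T1, A r i * h i = -(∑ i ∈ T0, A r i * h i + ∑ i ∈ T1, A r i * h i) := by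
      linarith
    rw [this]; ring
  rw [e]
  refine (neg_le_abs _).trans (hB.trans ?_)
  gcongr
  rw [← Finset.sum_sdiff hT1] at hcone
  have hM2 : √s * M ≤ (∑ i ∈ T1, |h i|) / √s := by
    rw [le_div_iff₀ hsp]; nlinarith
  calc _ ≤ (∑ i ∈ T1, |h i|) / √s + (∑ i ∈ T0ᶜ \ T1, |h i|) / √s := by gcongr
    _ = (∑ i ∈ T0ᶜ \ T1, |h i| + ∑ i ∈ T1, |h i|) / √s := by rw [add_div]; ring
    _ ≤ _ := by gcongr

lemma core1 {m n : ℕ} (A : Matrix (Fin m) (Fin n) ℝ) (N : ℕ) (δl δu δ : ℝ)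
    (hl : δl ≤ δ) (hu : δu ≤ δ) (hδ0 : 0 ≤ δ)
    (hR : RIP A N δl δu) (h : Fin n → ℝ) (hA : ∀ r, ∑ i, A r i * h i = 0)
    (T0 : Finset (Fin n)) (h1 : T0.card + 1 ≤ N)
    (hcone : ∑ i ∈ T0ᶜ, |h i| ≤ √(∑ i ∈ T0, h i ^ 2)) :
    (1 - δl) * (∑ i ∈ T0, h i ^ 2) ≤ δ * (∑ i ∈ T0, h i ^ 2) := by
  have hu2 : √(∑ i ∈ T0, h i ^ 2) * √(∑ i ∈ T0, h i ^ 2) = ∑ i ∈ T0, h i ^ 2 :=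
    Real.mul_self_sqrt (Finset.sum_nonneg (fun i _ => sq_nonneg _))
  have k1 := (rip_comb A N δl δu hR h T0 ∅ (by simp) (by simp; omega) 1 1).1
  simp only [one_mul, one_pow, Finset.sum_empty, add_zero] at k1
  refine k1.trans ?_
  have e : ∑ r, (∑ i ∈ T0, A r i * h i) ^ 2 =
      - ∑ j ∈ T0ᶜ, ∑ r, (∑ i ∈ T0, A r i * h i) * (∑ i ∈ {j}, A r i * h i) := by
    rw [Finset.sum_comm, ← Finset.sum_neg_distrib]
    refine Finset.sum_congr rfl (fun r _ => ?_)
    have := hA r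
    rw [← Finset.sum_add_sum_compl T0] at this
    simp only [Finset.sum_singleton]
    rw [← Finset.mul_sum, eq_neg_of_add_eq_zero_right this]; ring
  rw [e, ← hu2]
  refine (neg_le_abs _).trans ((Finset.abs_sum_le_sum_abs _ _).trans ?_)
  calc _ ≤ ∑ j ∈ T0ᶜ, δ * √(∑ i ∈ T0, h i ^ 2) * |h j| := by
        refine Finset.sum_le_sum (fun j hj => ?_)
        have := rip_inner A N δl δu δ hl hu hR h T0 {j} (by simpa using hj) (by simpa using h1)
        rwa [Finset.sum_singleton (fun i => h i ^ 2), Real.sqrt_sq_eq_abs] at this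
    _ = δ * √(∑ i ∈ T0, h i ^ 2) * ∑ j ∈ T0ᶜ, |h j| := by rw [Finset.mul_sum]
    _ ≤ δ * √(∑ i ∈ T0, h i ^ 2) * √(∑ i ∈ T0, h i ^ 2) := by gcongr
    _ = _ := by ring

lemma real_fin (u v κ σ δ l a : ℝ) (hu : 0 ≤ u) (hv : 0 ≤ v) (hκ : 0 < κ) (hσ : 0 < σ)
    (hδ : 0 ≤ δ) (hl : 0 < l) (ha : 2 * δ ^ 2 < a * l ^ 2) (hs : 3 * (a * κ ^ 2) ≤ 4 * σ ^ 2)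
    (hm : l * (u ^ 2 + v ^ 2) ≤ δ * (u + v) * (κ * u / σ)) : u = 0 := by
  by_contra hne
  have hu' : 0 < u := lt_of_le_of_ne hu (Ne.symm hne)
  have q : (u + v) * u ≤ 61/50 * (u ^ 2 + v ^ 2) := by nlinarith [sq_nonneg (v - 41/100 * u)]
  have hm2 : l * (u ^ 2 + v ^ 2) * σ ≤ δ * κ * ((u + v) * u) := by
    have : δ * (u + v) * (κ * u / σ) = δ * κ * ((u + v) * u) / σ := by ring
    rwa [this, le_div_iff₀ hσ] at hm
  have h3 : l * σ ≤ δ * κ * (61/50) := by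
    have hp : 0 < u ^ 2 + v ^ 2 := by positivity
    have := mul_le_mul_of_nonneg_left q (by positivity : 0 ≤ δ * κ)
    refine le_of_mul_le_mul_right ?_ hp
    nlinarith
  have h4 : (l * σ) ^ 2 ≤ (δ * κ * (61/50)) ^ 2 := pow_le_pow_left₀ (by positivity) h3 2
  have h5 : 2 * δ ^ 2 * κ ^ 2 < a * l ^ 2 * κ ^ 2 := by gcongr
  have h6 := mul_le_mul_of_nonneg_right hs (by positivity : 0 ≤ l ^ 2)
  nlinarith [sq_nonneg (δ * κ)]

theorem stmt2 {m n : ℕ} (A : Matrix (Fin m) (Fin n) ℝ)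
    (T : Finset (Fin n)) (kT : ℕ) (hkT : T.card = kT)
    (k : ℕ) (hk : 1 ≤ k) (a : ℝ) (ha : 0 < a)
    (K : ℝ) (hK : K = max ((a + 1) * k + kT) (2 * a * k))
    (δl δu : ℝ) (hδl0 : 0 < δl) (hδl1 : δl < 1) (hδu0 : 0 < δu)
    (hRIP : RIP A (Nat.ceil K) δl δu)
    (δ : ℝ) (hδ : δ = max δl δu)
    (ha2 : a > 2 * δ ^ 2 / (1 - δl) ^ 2)
    (x : Fin n → ℝ) (hxs : Sparse k x)
    (y : Fin m → ℝ) (hy : y = A.mulVec x)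
    -- `zhat` is a solution of noiseless tail-ℓ₁ minimization: min ‖z_{Tᶜ}‖₁ s.t. Az = y
    (zhat : Fin n → ℝ)
    (hfeas : A.mulVec zhat = y)
    (hopt : ∀ z : Fin n → ℝ, A.mulVec z = y → l1normOn Tᶜ zhat ≤ l1normOn Tᶜ z) :
    zhat = x := by
  obtain ⟨S, hSc, hS⟩ := hxs
  set h : Fin n → ℝ := fun i => zhat i - x i with hh
  have hA : ∀ r, ∑ i, A r i * h i = 0 := by
    intro r
    have := congrFun (hfeas.trans hy) r
    simp only [Matrix.mulVec, dotProduct] at this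
    simp only [hh, mul_sub, Finset.sum_sub_distrib, this, sub_self]
  have hl : δl ≤ δ := hδ ▸ le_max_left _ _
  have hu : δu ≤ δ := hδ ▸ le_max_right _ _
  have hδ0 : 0 ≤ δ := hδl0.le.trans hl
  have hl1 : 0 < 1 - δl := by linarith
  have ha3 : 2 * δ ^ 2 < a * (1 - δl) ^ 2 := by
    rwa [gt_iff_lt, div_lt_iff₀ (by positivity)] at ha2
  set T0 := T ∪ S with hT0
  have hT0c : T0.card ≤ kT + k := (Finset.card_union_le _ _).trans (by omega)
  have hsplit : Tᶜ = (S \ T) ∪ T0ᶜ := by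
    ext i; simp only [hT0, Finset.mem_compl, Finset.mem_union, Finset.mem_sdiff]; tauto
  have hdis : Disjoint (S \ T) T0ᶜ := by
    rw [Finset.disjoint_left]; intro i hi; simp only [hT0, Finset.mem_compl, Finset.mem_union, Finset.mem_sdiff] at hi ⊢; tauto
  have hc1 : ∑ i ∈ T0ᶜ, |h i| ≤ ∑ i ∈ S \ T, |h i| := by
    have := hopt x hy.symm
    simp only [l1normOn] at this
    rw [hsplit, Finset.sum_union hdis, Finset.sum_union hdis] at this
    have e1 : ∑ i ∈ T0ᶜ, |x i| = 0 := Finset.sum_eq_zero (fun i hi => by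
      have : i ∉ S := by simp [hT0] at hi; exact hi.2
      simp [hS i this])
    have e2 : ∑ i ∈ T0ᶜ, |zhat i| = ∑ i ∈ T0ᶜ, |h i| := Finset.sum_congr rfl (fun i hi => by
      have : i ∉ S := by simp [hT0] at hi; exact hi.2
      simp [hh, hS i this])
    have e3 : ∑ i ∈ S \ T, |x i| ≤ ∑ i ∈ S \ T, |zhat i| + ∑ i ∈ S \ T, |h i| := by
      rw [← Finset.sum_add_distrib]
      refine Finset.sum_le_sum (fun i _ => ?_)
      have := abs_sub (zhat i) (h i)
      simpa [hh] using this
    linarith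
  have hcone : ∑ i ∈ T0ᶜ, |h i| ≤ √k * √(∑ i ∈ T0, h i ^ 2) := by
    refine hc1.trans ?_
    rw [← Real.sqrt_mul (by positivity)]
    apply Real.le_sqrt_of_sq_le
    have cs := sq_sum_le_card_mul_sum_sq (s := S \ T) (f := fun i => |h i|)
    simp only [sq_abs] at cs
    have c1 : ((S \ T).card : ℝ) ≤ k := by
      exact_mod_cast (Finset.card_le_card Finset.sdiff_subset).trans hSc
    have c2 : ∑ i ∈ S \ T, h i ^ 2 ≤ ∑ i ∈ T0, h i ^ 2 :=
      Finset.sum_le_sum_of_subset_of_nonneg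
        (Finset.sdiff_subset.trans Finset.subset_union_right) (fun i _ _ => sq_nonneg _)
    exact cs.trans (mul_le_mul c1 c2 (Finset.sum_nonneg (fun i _ => sq_nonneg _)) (by positivity))
  have hnn : 0 ≤ ∑ i ∈ T0, h i ^ 2 := Finset.sum_nonneg (fun i _ => sq_nonneg _)
  suffices hz : √(∑ i ∈ T0, h i ^ 2) = 0 by
    rw [hz, mul_zero] at hcone
    rw [Real.sqrt_eq_zero hnn, Finset.sum_eq_zero_iff_of_nonneg (fun i _ => sq_nonneg _)] at hz
    have hcz := (Finset.sum_eq_zero_iff_of_nonneg (fun i _ => abs_nonneg (h i))).1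
      (le_antisymm hcone (Finset.sum_nonneg (fun i _ => abs_nonneg _)))
    funext i
    have : h i = 0 := by
      by_cases hi : i ∈ T0
      · simpa using hz i hi
      · simpa using hcz i (by simpa using hi)
    simpa [hh, sub_eq_zero] using this
  have hk0 : (0:ℝ) < k := by exact_mod_cast hk
  have hak : 0 < a * k := by positivity
  set N := Nat.ceil K with hN
  set c := Nat.ceil (a * k) with hcdef
  have hc0 : 1 ≤ c := Nat.ceil_pos.2 hak
  have hKN : K ≤ N := Nat.le_ceil K
  have hN1 : k + kT + c ≤ N := by
    have h1 : a * k ≤ ((N : ℤ) - k - kT : ℤ) := by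
      push_cast
      have := (le_max_left ((a + 1) * k + kT) (2 * a * k)).trans (hK ▸ hKN)
      linarith
    have h2 := Int.ceil_le.2 h1
    have h3 : (c : ℤ) = ⌈a * k⌉ := Int.natCast_ceil_eq_ceil hak.le
    omega
  have hN2 : 2 * (a * k) ≤ N := by
    have := (le_max_right ((a + 1) * k + kT) (2 * a * k)).trans (hK ▸ hKN)
    linarith
  have fin : ∀ s : ℕ, 1 ≤ s → k + kT + s ≤ N → s + s ≤ N → 3 * (a * k) ≤ 4 * s →
      √(∑ i ∈ T0, h i ^ 2) = 0 := by
    intro s hs h1 h2 h3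
    obtain ⟨v, hv, hm⟩ := core A N δl δu δ hl hu hδ0 hRIP h hA T0 k s hs (by omega) h2 hcone
    have hs0 : (0:ℝ) < s := by exact_mod_cast hs
    refine real_fin _ v (√k) (√s) δ (1 - δl) a (Real.sqrt_nonneg _) hv (Real.sqrt_pos.2 hk0)
      (Real.sqrt_pos.2 hs0) hδ0 hl1 ha3 ?_ ?_
    · rwa [Real.sq_sqrt hk0.le, Real.sq_sqrt hs0.le]
    · rwa [Real.sq_sqrt hnn]
  have hcle : a * k ≤ c := Nat.le_ceil _
  by_cases hcase : c + c ≤ N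
  · exact fin c hc0 hN1 hcase (by linarith)
  have hN3 : N + 1 ≤ c + c := by omega
  have hclt : (c : ℝ) < a * k + 1 := Nat.ceil_lt_add_one hak.le
  have hak2 : 2 * (a * k) + 1 ≤ 2 * c := by
    have : ((N + 1 : ℕ) : ℝ) ≤ ((c + c : ℕ) : ℝ) := by exact_mod_cast hN3
    push_cast at this; linarith
  rcases Nat.lt_or_ge c 3 with h3 | h3
  · have hc2 : c = 2 := by omega
    have hk1 : k = 1 := by omega
    have hkT0 : kT = 0 := by omega
    rw [hc2, hk1] at hak2
    push_cast at hak2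
    rw [hk1] at hcone
    have hm := core1 A N δl δu δ hl hu hδ0 hRIP h hA T0 (by omega) (by simpa using hcone)
    by_contra hne
    have hp : 0 < ∑ i ∈ T0, h i ^ 2 := by
      rcases hnn.eq_or_lt with h0 | h0
      · exact absurd (by rw [← h0, Real.sqrt_zero]) hne
      · exact h0
    have h4 : 1 - δl ≤ δ := le_of_mul_le_mul_right hm hp
    have h5 : (1 - δl) ^ 2 ≤ δ ^ 2 := pow_le_pow_left₀ hl1.le h4 2
    nlinarith [sq_nonneg (1 - δl)]
  · obtain ⟨d, hd⟩ : ∃ d, c = d + 1 := ⟨c - 1, by omega⟩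
    have hcd : (c : ℝ) = d + 1 := by rw [hd]; push_cast; ring
    have hd2 : (2 : ℝ) ≤ d := by exact_mod_cast (by omega : 2 ≤ d)
    have : d + d ≤ N := by
      have : ((d + d : ℕ) : ℝ) < N := by push_cast; linarith
      exact_mod_cast this.le
    exact fin d (by omega) (by omega) this (by linarith)
end

section
/- Let T ⊆ {1,…,n}, let x ∈ ℝⁿ satisfy ‖Ax − y‖₂ ≤ ε, and let ẑ be a solution of the tail-ℓ₁ minimization problem min_{z ∈ ℝⁿ} ‖z_{T^c}‖₁ subject to ‖Az − y‖₂ ≤ ε. Let S₀ ⊆ T^c be a set of k indices of the largest-magnitude entries of x_{T^c}, and set h = ẑ − x. Then ‖h_{T^c ∩ S₀^c}‖₁ ≤ ‖h_{S₀}‖₁ + 2‖x_{T^c ∩ S₀^c}‖₁. -/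
open scoped BigOperators

theorem stmt3 {m n : ℕ} (A : Matrix (Fin m) (Fin n) ℝ) (y : Fin m → ℝ) (ε : ℝ)
    (hε : 0 ≤ ε) (T : Finset (Fin n))
    (x : Fin n → ℝ) (hx : l2norm (A.mulVec x - y) ≤ ε)
    -- `S₀ ⊆ Tᶜ` is a set of `k` indices of the largest-magnitude entries of `x` on `Tᶜ`
    (k : ℕ) (S0 : Finset (Fin n)) (hS0T : S0 ⊆ Tᶜ) (hS0card : S0.card = k)
    (hS0max : ∀ i ∈ S0, ∀ j ∈ Tᶜ \ S0, |x j| ≤ |x i|)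
    -- `zhat` is a solution of the tail-ℓ₁ minimization problem
    (zhat : Fin n → ℝ)
    (hfeas : l2norm (A.mulVec zhat - y) ≤ ε)
    (hopt : ∀ z : Fin n → ℝ, l2norm (A.mulVec z - y) ≤ ε →
      l1normOn Tᶜ zhat ≤ l1normOn Tᶜ z)
    (h : Fin n → ℝ) (hh : h = zhat - x) :
    l1normOn (Tᶜ \ S0) h ≤ l1normOn S0 h + 2 * l1normOn (Tᶜ \ S0) x := by
  have key := hopt x hx
  unfold l1normOn at *
  rw [← Finset.sum_sdiff hS0T, ← Finset.sum_sdiff hS0T] at key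
  have h1 : ∑ i ∈ Tᶜ \ S0, |h i| ≤ ∑ i ∈ Tᶜ \ S0, |zhat i| + ∑ i ∈ Tᶜ \ S0, |x i| := by
    rw [← Finset.sum_add_distrib]
    refine Finset.sum_le_sum fun i _ => ?_
    rw [hh]
    exact abs_sub _ _
  have h2 : ∑ i ∈ S0, |x i| ≤ ∑ i ∈ S0, |h i| + ∑ i ∈ S0, |zhat i| := by
    rw [← Finset.sum_add_distrib]
    refine Finset.sum_le_sum fun i _ => ?_
    rw [hh, Pi.sub_apply]
    have := abs_sub_abs_le_abs_sub (x i) (zhat i)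
    rw [abs_sub_comm] at this
    linarith
  linarith
end

section
/- Let T ⊆ {1,…,n} with |T| = k_T, let k ≥ 1 be an integer, let a > 0, and set K′ = max{ak + k_T, 2ak}. Suppose A ∈ ℝ^{m×n} satisfies the order-K′ RIP with constants 0 < δ_{K′,l} < 1 and δ_{K′,u} > 0, and set δ_{K′} = max{δ_{K′,l}, δ_{K′,u}}. Then for every x ∈ ℝⁿ and every w ∈ ℝ^m with ‖w‖₂ ≤ ε, any solution ẑ of the tail-ℓ₁ minimization problem with y = Ax + w satisfies ‖ẑ − x‖₂ ≤ C₁ ε + C₂ ‖x_{T^c}‖₁ / √(ak), where C₁ = 2√(1+δ_{K′}) / (1−δ_{K′,l}) and C₂ = 2√2 δ_{K′} / (1−δ_{K′,l}) + 2. -/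
open scoped BigOperators

def res {n : ℕ} (B : Finset (Fin n)) (v : Fin n → ℝ) : Fin n → ℝ :=
  fun i => if i ∈ B then v i else 0

lemma l2norm_nonneg {n : ℕ} (x : Fin n → ℝ) : 0 ≤ l2norm x := Real.sqrt_nonneg _

lemma l2norm_sq {n : ℕ} (x : Fin n → ℝ) : l2norm x ^ 2 = ∑ i, x i ^ 2 :=
  Real.sq_sqrt (Finset.sum_nonneg fun i _ => sq_nonneg _)

lemma l2norm_eq {n : ℕ} (x : Fin n → ℝ) : l2norm x = ‖WithLp.toLp 2 x‖ := by
  rw [EuclideanSpace.norm_eq]; simp [l2norm]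

lemma l2norm_add {n : ℕ} (x y : Fin n → ℝ) : l2norm (x + y) ≤ l2norm x + l2norm y := by
  simp only [l2norm_eq, WithLp.toLp_add]
  exact norm_add_le _ _

lemma l2norm_neg {n : ℕ} (x : Fin n → ℝ) : l2norm (-x) = l2norm x := by
  simp [l2norm]

lemma dot_le {n : ℕ} (x y : Fin n → ℝ) : |∑ i, x i * y i| ≤ l2norm x * l2norm y := by
  apply abs_le_of_sq_le_sq _ (mul_nonneg (l2norm_nonneg _) (l2norm_nonneg _))
  rw [mul_pow, l2norm_sq, l2norm_sq]
  exact Finset.sum_mul_sq_le_sq_mul_sq _ _ _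

lemma l2norm_res_sq {n : ℕ} (B : Finset (Fin n)) (v : Fin n → ℝ) :
    l2norm (res B v) ^ 2 = ∑ i ∈ B, v i ^ 2 := by
  rw [l2norm_sq]; simp [res, ite_pow, Finset.sum_ite_mem]

lemma l2norm_res {n : ℕ} (B : Finset (Fin n)) (v : Fin n → ℝ) :
    l2norm (res B v) = √ (∑ i ∈ B, v i ^ 2) := by
  rw [← l2norm_res_sq, Real.sqrt_sq (l2norm_nonneg _)]

lemma res_union {n : ℕ} (B B' : Finset (Fin n)) (h : Disjoint B B') (v : Fin n → ℝ) :
    res (B ∪ B') v = res B v + res B' v := by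
  ext i
  have := fun q : i ∈ B => Finset.disjoint_left.mp h q
  by_cases h1 : i ∈ B <;> by_cases h2 : i ∈ B' <;> simp_all [res]

lemma top_exists {n : ℕ} (v : Fin n → ℝ) (S : Finset (Fin n)) (r : ℕ) (hr : r ≤ S.card) :
    ∃ B ⊆ S, B.card = r ∧ ∀ i ∈ B, ∀ j ∈ S \ B, |v j| ≤ |v i| := by
  induction r with
  | zero => exact ⟨∅, by simp⟩
  | succ r ih =>
    obtain ⟨B, hBS, hB, h⟩ := ih (by omega)
    have hne : (S \ B).Nonempty := by
      rw [← Finset.card_pos, Finset.card_sdiff_of_subset hBS]; omega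
    obtain ⟨a, ha, hmax⟩ := Finset.exists_max_image (S \ B) (fun i => |v i|) hne
    have ha' := Finset.mem_sdiff.mp ha
    refine ⟨insert a B, ?_, ?_, ?_⟩
    · intro i hi
      rcases Finset.mem_insert.mp hi with rfl | hi
      · exact ha'.1
      · exact hBS hi
    · rw [Finset.card_insert_of_notMem ha'.2, hB]
    · intro i hi j hj
      have hj' : j ∈ S \ B := by
        simp only [Finset.mem_sdiff, Finset.mem_insert, not_or] at hj ⊢; tauto
      rcases Finset.mem_insert.mp hi with rfl | hi
      · exact hmax j hj'
      · exact h i hi j hj'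

/-- block bound -/
lemma block_bound {n : ℕ} (v : Fin n → ℝ) (B : Finset (Fin n)) (q : ℕ) (hq : 1 ≤ q)
    (M m : ℝ) (hM : ∀ i ∈ B, |v i| ≤ M) (hM0 : 0 ≤ M)
    (hm : q * m ≤ ∑ i ∈ B, |v i|) :
    √ (∑ i ∈ B, v i ^ 2) ≤ (∑ i ∈ B, |v i|) / √ q + √ q / 2 * (M - m) := by
  have hq0 : (0:ℝ) < q := by exact_mod_cast hq
  have hs : 0 < √ (q:ℝ) := Real.sqrt_pos.mpr hq0
  have hss : √ (q:ℝ) ^ 2 = q := Real.sq_sqrt hq0.le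
  set S := ∑ i ∈ B, |v i| with hS
  have hS0 : 0 ≤ S := Finset.sum_nonneg fun _ _ => abs_nonneg _
  have h1 : ∑ i ∈ B, v i ^ 2 ≤ M * S := by
    rw [hS, Finset.mul_sum]
    apply Finset.sum_le_sum
    intro i hi
    rw [← sq_abs]
    nlinarith [hM i hi, abs_nonneg (v i)]
  have h2 : √ (∑ i ∈ B, v i ^ 2) ≤ (S / √ q + √ q * M) / 2 := by
    apply Real.sqrt_le_iff.mpr
    constructor
    · positivity
    · have : M * S = (S / √ q) * (√ q * M) := by field_simp
      nlinarith [sq_nonneg (S / √ q - √ q * M)]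
  have h3 : √ q * m ≤ S / √ q := by
    rw [le_div_iff₀ hs]; nlinarith
  linarith

lemma tail_bound {n : ℕ} (v : Fin n → ℝ) (q : ℕ) (hq : 1 ≤ q)
    (G : Finset (Fin n) → ℝ) (C : ℝ) (hC : 0 ≤ C)
    (hsub : ∀ B B', Disjoint B B' → G (B ∪ B') ≤ G B + G B') :
    ∀ N : ℕ, ∀ S : Finset (Fin n), S.card ≤ N → ∀ M : ℝ, 0 ≤ M → (∀ i ∈ S, |v i| ≤ M) →
    (∀ B ⊆ S, B.card ≤ q → G B ≤ C * √ (∑ i ∈ B, v i ^ 2)) →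
    G S ≤ C * ((∑ i ∈ S, |v i|) / √ q + √ q / 2 * M) := by
  intro N
  induction N with
  | zero =>
    intro S hS M hM0 hM hb
    have := block_bound v S q hq M 0 hM hM0 (by
      rw [mul_zero]; exact Finset.sum_nonneg fun _ _ => abs_nonneg _)
    rw [sub_zero] at this
    exact (hb S subset_rfl (by omega)).trans (mul_le_mul_of_nonneg_left this hC)
  | succ N ih =>
    intro S hS M hM0 hM hb
    by_cases hc : S.card ≤ q
    · have := block_bound v S q hq M 0 hM hM0 (by
        rw [mul_zero]; exact Finset.sum_nonneg fun _ _ => abs_nonneg _)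
      rw [sub_zero] at this
      exact (hb S subset_rfl hc).trans (mul_le_mul_of_nonneg_left this hC)
    · obtain ⟨B, hBS, hB, h⟩ := top_exists v S q (by omega)
      have hne : B.Nonempty := by rw [← Finset.card_pos]; omega
      obtain ⟨b, hbB, hmin⟩ := Finset.exists_min_image B (fun i => |v i|) hne
      have e1 := block_bound v B q hq M |v b| (fun i hi => hM i (hBS hi)) hM0 (by
        have := Finset.card_nsmul_le_sum B (fun i => |v i|) |v b| hmin
        rw [hB, nsmul_eq_mul] at this; exact this)
      have e2 := ih (S \ B) (by rw [Finset.card_sdiff_of_subset hBS]; omega) |v b|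
        (abs_nonneg _) (fun j hj => h b hbB j hj)
        (fun B' hB' => hb B' (hB'.trans Finset.sdiff_subset))
      have e3 := hsub B (S \ B) Finset.disjoint_sdiff
      rw [Finset.union_sdiff_of_subset hBS] at e3
      have e4 := hb B hBS hB.le
      have e5 := mul_le_mul_of_nonneg_left e1 hC
      have e6 : ∑ i ∈ S, |v i| = ∑ i ∈ S \ B, |v i| + ∑ i ∈ B, |v i| :=
        (Finset.sum_sdiff hBS).symm
      rw [e6]
      calc G S ≤ _ := e3
        _ ≤ _ := add_le_add (e4.trans e5) e2
        _ = _ := by ring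

lemma tail_exists {n : ℕ} (v : Fin n → ℝ) (S : Finset (Fin n)) (r q : ℕ) (hq : 1 ≤ q)
    (hrq : q ≤ 2 * r ∨ (r = 0 ∧ q = 1)) :
    ∃ T₁ ⊆ S, T₁.card ≤ r ∧ ∀ (G : Finset (Fin n) → ℝ) (C : ℝ), 0 ≤ C →
      (∀ B B', Disjoint B B' → G (B ∪ B') ≤ G B + G B') →
      (∀ B ⊆ S \ T₁, B.card ≤ q → G B ≤ C * √ (∑ i ∈ B, v i ^ 2)) →
      G (S \ T₁) ≤ C * ((∑ i ∈ S, |v i|) / √ q) := by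
  have hq0 : (0:ℝ) < q := by exact_mod_cast hq
  have hs : 0 < √ (q:ℝ) := Real.sqrt_pos.mpr hq0
  have hss : √ (q:ℝ) ^ 2 = q := Real.sq_sqrt hq0.le
  rcases hrq with hrq | ⟨rfl, rfl⟩
  · by_cases hc : r ≤ S.card
    · obtain ⟨B, hBS, hB, h⟩ := top_exists v S r hc
      refine ⟨B, hBS, hB.le, ?_⟩
      intro G C hC hsub hb
      have hne : B.Nonempty := by rw [← Finset.card_pos]; omega
      obtain ⟨b, hbB, hmin⟩ := Finset.exists_min_image B (fun i => |v i|) hne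
      have e1 := tail_bound v q hq G C hC hsub _ (S \ B) le_rfl |v b| (abs_nonneg _)
        (fun j hj => h b hbB j hj) hb
      have e2 := Finset.card_nsmul_le_sum B (fun i => |v i|) |v b| hmin
      rw [hB, nsmul_eq_mul] at e2
      refine e1.trans (mul_le_mul_of_nonneg_left ?_ hC)
      rw [← Finset.sum_sdiff hBS, add_div]
      gcongr
      rw [le_div_iff₀ hs]
      have h3 : (q:ℝ) ≤ 2 * r := by exact_mod_cast hrq
      nlinarith [abs_nonneg (v b)]
    · refine ⟨S, subset_rfl, by omega, ?_⟩
      intro G C hC hsub hb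
      have := hb (S \ S) subset_rfl (by simp)
      refine this.trans ?_
      simp
      have : 0 ≤ ∑ i ∈ S, |v i| := Finset.sum_nonneg fun _ _ => abs_nonneg _
      positivity
  · refine ⟨∅, by simp, by simp, ?_⟩
    intro G C hC hsub hb
    simp only [Finset.sdiff_empty, Nat.cast_one, Real.sqrt_one, div_one] at hb ⊢
    have key : ∀ S' : Finset (Fin n), S' ⊆ S → G S' ≤ C * ∑ i ∈ S', |v i| := by
      intro S'
      induction S' using Finset.induction_on with
      | empty => intro _; simpa using hb ∅ (by simp) (by simp)
      | insert a s ha ih =>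
        intro hsS
        have e1 := ih ((Finset.subset_insert _ _).trans hsS)
        have e2 := hb {a} (by simpa using hsS (Finset.mem_insert_self a s)) (by simp)
        simp only [Finset.sum_singleton, Real.sqrt_sq_eq_abs] at e2
        have e3 := hsub {a} s (by simpa using ha)
        rw [Finset.sum_insert ha, Finset.insert_eq]
        linarith
    exact key S subset_rfl

lemma rip_dot {m n : ℕ} (A : Matrix (Fin m) (Fin n) ℝ) (K : ℕ) (δl δu δ : ℝ)
    (hR : RIP A K δl δu) (hδ : δ = max δl δu) (v : Fin n → ℝ) (U V : Finset (Fin n))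
    (hd : Disjoint U V) (hc : U.card + V.card ≤ K) :
    |∑ i, A.mulVec (res U v) i * A.mulVec (res V v) i| ≤ δ * l2norm (res U v) * l2norm (res V v) := by
  set α := l2norm (res V v) with hα
  set β := l2norm (res U v) with hβ
  have hα0 : 0 ≤ α := l2norm_nonneg _
  have hβ0 : 0 ≤ β := l2norm_nonneg _
  have hα2 : α ^ 2 = ∑ i, res V v i ^ 2 := l2norm_sq _
  have hβ2 : β ^ 2 = ∑ i, res U v i ^ 2 := l2norm_sq _
  have hl : δl ≤ δ := hδ ▸ le_max_left _ _
  have hu : δu ≤ δ := hδ ▸ le_max_right _ _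
  have key : ∀ c d : ℝ, 
     (1 - δl) * (c^2*β^2 + d^2*α^2) ≤ (∑ i, (c * A.mulVec (res U v) i + d * A.mulVec (res V v) i) ^ 2) ∧
      (∑ i, (c * A.mulVec (res U v) i + d * A.mulVec (res V v) i) ^ 2) ≤ (1 + δu) * (c^2*β^2 + d^2*α^2) := by
    intro c d
    have := hR (c • res U v + d • res V v) ⟨U ∪ V, (Finset.card_union_le _ _).trans hc, by
      intro i hi
      simp only [Finset.mem_union, not_or] at hi
      simp [res, hi.1, hi.2]⟩
    have e : ∑ i, (c • res U v + d • res V v) i ^ 2 = c^2*β^2 + d^2*α^2 := by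
      rw [hα2, hβ2, Finset.mul_sum, Finset.mul_sum, ← Finset.sum_add_distrib]
      apply Finset.sum_congr rfl
      intro i _
      have := fun q : i ∈ U => Finset.disjoint_left.mp hd q
      by_cases h1 : i ∈ U <;> by_cases h2 : i ∈ V <;> simp_all [res] <;> ring
    rw [e] at this
    simpa [Matrix.mulVec_add, Matrix.mulVec_smul] using this
  have pol : ∀ c d : ℝ, (∑ i, (c * A.mulVec (res U v) i + d * A.mulVec (res V v) i) ^ 2) -
      (∑ i, (c * A.mulVec (res U v) i + (-d) * A.mulVec (res V v) i) ^ 2) =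
      4 * (c * d) * ∑ i, A.mulVec (res U v) i * A.mulVec (res V v) i := by
    intro c d
    rw [← Finset.sum_sub_distrib, Finset.mul_sum]
    apply Finset.sum_congr rfl
    intro i _; ring
  set X := ∑ i, A.mulVec (res U v) i * A.mulVec (res V v) i with hX
  have zero_case : ∀ W : Finset (Fin n), l2norm (res W v) = 0 → res W v = 0 := by
    intro W hW
    rw [l2norm_eq, norm_eq_zero] at hW
    simpa using hW
  rcases hα0.eq_or_lt with h0 | hαp
  · have := zero_case V (by rw [← hα, ← h0])
    rw [← h0, hX, this]; simp
  rcases hβ0.eq_or_lt with h0 | hβp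
  · have := zero_case U (by rw [← hβ, ← h0])
    rw [← h0, hX, this]; simp
  have hp : 0 < α * β := mul_pos hαp hβp
  have a1 := key α β
  have a2 := key α (-β)
  have a3 := pol α β
  have hq : (δl + δu) * (α*β)^2 ≤ 2 * δ * (α*β)^2 :=
    mul_le_mul_of_nonneg_right (by linarith) (sq_nonneg _)
  have b1 : (α * β) * X ≤ (α * β) * (δ * β * α) := by nlinarith
  have b2 : (α * β) * (-X) ≤ (α * β) * (δ * β * α) := by nlinarith
  exact abs_le.mpr ⟨by linarith [le_of_mul_le_mul_left b2 hp], le_of_mul_le_mul_left b1 hp⟩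

theorem stmt4 {m n : ℕ} (A : Matrix (Fin m) (Fin n) ℝ)
    (T : Finset (Fin n)) (kT : ℕ) (hkT : T.card = kT)
    (k : ℕ) (hk : 1 ≤ k) (a : ℝ) (ha : 0 < a)
    (K' : ℝ) (hK' : K' = max (a * k + kT) (2 * a * k))
    (δl δu : ℝ) (hδl0 : 0 < δl) (hδl1 : δl < 1) (hδu0 : 0 < δu)
    (hRIP : RIP A (Nat.ceil K') δl δu)
    (δ : ℝ) (hδ : δ = max δl δu)
    (ε : ℝ) (x : Fin n → ℝ) (w : Fin m → ℝ) (hw : l2norm w ≤ ε)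
    (y : Fin m → ℝ) (hy : y = A.mulVec x + w)
    -- `zhat` is a solution of the tail-ℓ₁ minimization problem
    (zhat : Fin n → ℝ)
    (hfeas : l2norm (A.mulVec zhat - y) ≤ ε)
    (hopt : ∀ z : Fin n → ℝ, l2norm (A.mulVec z - y) ≤ ε →
      l1normOn Tᶜ zhat ≤ l1normOn Tᶜ z) :
    l2norm (zhat - x) ≤
      2 * Real.sqrt (1 + δ) / (1 - δl) * ε
        + (2 * Real.sqrt 2 * δ / (1 - δl) + 2) * (l1normOn Tᶜ x / Real.sqrt (a * k)) := by
  subst hy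
  have hε : 0 ≤ ε := (l2norm_nonneg _).trans hw
  set h : Fin n → ℝ := zhat - x with hh
  set σ := l1normOn Tᶜ x with hσ
  set s : ℝ := a * k with hs
  have hkpos : (0:ℝ) < k := by exact_mod_cast hk
  have hspos : 0 < s := mul_pos ha hkpos
  have hss : 0 < √ s := Real.sqrt_pos.mpr hspos
  have hσ0 : 0 ≤ σ := Finset.sum_nonneg fun _ _ => abs_nonneg _
  have hδl : δl ≤ δ := hδ ▸ le_max_left _ _
  have hδu : δu ≤ δ := hδ ▸ le_max_right _ _
  have hδ0 : 0 < δ := hδl0.trans_le hδl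
  -- tail l1 bound
  have hτ : ∑ i ∈ Tᶜ, |h i| ≤ 2 * σ := by
    have h1 : l1normOn Tᶜ zhat ≤ σ := hopt x (by
      have : A.mulVec x - (A.mulVec x + w) = -w := by abel
      rw [this, l2norm_neg]; exact hw)
    have h2 : ∑ i ∈ Tᶜ, |h i| ≤ l1normOn Tᶜ zhat + σ := by
      rw [hσ, l1normOn, l1normOn, ← Finset.sum_add_distrib]
      exact Finset.sum_le_sum fun i _ => abs_sub _ _
    linarith
  -- feasibility
  have hAh : l2norm (A.mulVec h) ≤ 2 * ε := by
    have e : A.mulVec h = (A.mulVec zhat - (A.mulVec x + w)) + w := by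
      rw [hh, Matrix.mulVec_sub]; abel
    rw [e]
    linarith [l2norm_add (A.mulVec zhat - (A.mulVec x + w)) w]
  -- sizes
  obtain ⟨q, hq⟩ : ∃ q, q = ⌈s⌉₊ := ⟨_, rfl⟩
  obtain ⟨K, hK⟩ : ∃ K, K = ⌈K'⌉₊ := ⟨_, rfl⟩
  obtain ⟨p, hp⟩ : ∃ p, p = ⌈2 * s⌉₊ := ⟨_, rfl⟩
  rw [← hK] at hRIP
  have hq1 : 1 ≤ q := by rw [hq]; exact Nat.ceil_pos.mpr hspos
  have hqs : s ≤ q := hq ▸ Nat.le_ceil s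
  have hqs' : (q:ℝ) < s + 1 := hq ▸ Nat.ceil_lt_add_one hspos.le
  have hps : 2 * s ≤ p := hp ▸ Nat.le_ceil _
  have hps' : (p:ℝ) < 2 * s + 1 := hp ▸ Nat.ceil_lt_add_one (by positivity)
  have hpK : p ≤ K := by
    rw [hp, hK, hK']; apply Nat.ceil_mono
    exact le_trans (by rw [hs]; linarith) (le_max_right _ _)
  have hqK : q + kT ≤ K := by
    rw [hq, hK, hK', ← Nat.ceil_add_natCast hspos.le]; apply Nat.ceil_mono
    exact le_max_left _ _
  have hqp : q ≤ p := by
    rw [hq, hp]; exact Nat.ceil_mono (by linarith)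
  have hp2q : p ≤ 2 * q := by
    rw [hp]; apply Nat.ceil_le.mpr; push_cast; linarith
  have h2qp : 2 * q ≤ p + 1 := by
    have : (2 * q : ℝ) < p + 2 := by linarith
    have : 2 * q < p + 2 := by exact_mod_cast this
    omega
  obtain ⟨r, hr⟩ : ∃ r, r = p - q := ⟨_, rfl⟩
  obtain ⟨T₁, hT₁, hT₁c, hG⟩ := tail_exists h Tᶜ r q hq1 (by omega)
  have hdis : Disjoint T T₁ := by
    rw [Finset.disjoint_left]; intro i hi hi'
    exact (Finset.mem_compl.mp (hT₁ hi')) hi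
  set R := (∑ i ∈ Tᶜ, |h i|) / √ (q:ℝ) with hRdef
  have hRb : R ≤ 2 * (σ / √ s) := by
    rw [← mul_div_assoc]
    exact div_le_div₀ (by positivity) hτ hss (Real.sqrt_le_sqrt hqs)
  have hR0 : 0 ≤ R := div_nonneg (Finset.sum_nonneg fun _ _ => abs_nonneg _) (Real.sqrt_nonneg _)
  set t := res (Tᶜ \ T₁) h with ht
  have htn : l2norm t ≤ R := by
    have := hG (fun B => l2norm (res B h)) 1 zero_le_one
      (fun B B' hd => by simp only [res_union B B' hd]; exact l2norm_add _ _)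
      (fun B _ _ => by simp only [l2norm_res, one_mul]; exact le_rfl)
    simpa using this
  have hdot : ∀ U : Finset (Fin n), U.card + q ≤ K → Disjoint U (Tᶜ \ T₁) →
      |∑ i, A.mulVec (res U h) i * A.mulVec t i| ≤ δ * l2norm (res U h) * R := by
    intro U hU hd
    refine hG (fun B => |∑ i, A.mulVec (res U h) i * A.mulVec (res B h) i|) _
      (mul_nonneg hδ0.le (l2norm_nonneg _)) ?_ ?_
    · intro B B' hBB
      simp only [res_union B B' hBB, Matrix.mulVec_add, Pi.add_apply, mul_add,
        Finset.sum_add_distrib]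
      exact abs_add_le _ _
    · intro B hB hBc
      rw [← l2norm_res]
      exact rip_dot A K δl δu δ hRIP hδ h U B (Finset.disjoint_of_subset_right hB hd) (by omega)
  have hd1 := hdot T (by omega) (by
    rw [Finset.disjoint_left]; intro i hi hi'; simp at hi'; tauto)
  have hd2 := hdot T₁ (by omega) Finset.disjoint_sdiff
  set u := res (T ∪ T₁) h with hu
  have huu : u = res T h + res T₁ h := res_union _ _ hdis h
  have hsplit : h = u + t := by
    ext i
    by_cases h1 : i ∈ T <;> by_cases h2 : i ∈ T₁ <;> simp [hu, ht, res, h1, h2]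
  have hrip := hRIP u ⟨T ∪ T₁, (Finset.card_union_le _ _).trans (by omega), by
    intro i hi; simp [hu, res, hi]⟩
  rw [← l2norm_sq, ← l2norm_sq] at hrip
  have hu0 := l2norm_nonneg u
  have hsum : l2norm (res T h) + l2norm (res T₁ h) ≤ √2 * l2norm u := by
    have e : l2norm u ^ 2 = l2norm (res T h) ^ 2 + l2norm (res T₁ h) ^ 2 := by
      rw [hu, l2norm_res_sq, l2norm_res_sq, l2norm_res_sq, Finset.sum_union hdis]
    apply abs_le_of_sq_le_sq' _ (by positivity) |>.2
    rw [mul_pow, Real.sq_sqrt (by norm_num), e]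
    nlinarith [sq_nonneg (l2norm (res T h) - l2norm (res T₁ h))]
  have hAu : l2norm (A.mulVec u) ≤ √ (1 + δ) * l2norm u := by
    apply abs_le_of_sq_le_sq' _ (by positivity) |>.2
    rw [mul_pow, Real.sq_sqrt (by linarith)]
    exact hrip.2.trans (mul_le_mul_of_nonneg_right (by linarith) (sq_nonneg _))
  have hexp : l2norm (A.mulVec u) ^ 2 = ∑ i, A.mulVec u i * A.mulVec h i
      - (∑ i, A.mulVec (res T h) i * A.mulVec t i)
      - (∑ i, A.mulVec (res T₁ h) i * A.mulVec t i) := by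
    rw [l2norm_sq, ← Finset.sum_sub_distrib, ← Finset.sum_sub_distrib]
    apply Finset.sum_congr rfl
    intro i _
    have e1 : A.mulVec h i = A.mulVec u i + A.mulVec t i := by
      conv_lhs => rw [hsplit, Matrix.mulVec_add]
      rfl
    have e2 : A.mulVec u i = A.mulVec (res T h) i + A.mulVec (res T₁ h) i := by
      rw [huu, Matrix.mulVec_add]; rfl
    rw [e1, e2]; ring
  have hcs := (le_abs_self _).trans (dot_le (A.mulVec u) (A.mulVec h))
  have hcs2 : l2norm (A.mulVec u) * l2norm (A.mulVec h) ≤ (√ (1 + δ) * l2norm u) * (2 * ε) :=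
    mul_le_mul hAu hAh (l2norm_nonneg _) (by positivity)
  have hfin : (1 - δl) * l2norm u ^ 2 ≤
      l2norm u * (2 * √ (1 + δ) * ε + √2 * δ * R) := by
    have := mul_le_mul_of_nonneg_left hsum (mul_nonneg hδ0.le hR0)
    nlinarith [(abs_le.mp hd1).1, (abs_le.mp hd2).1, hrip.1]
  have h1δ : 0 < 1 - δl := by linarith
  have hub : l2norm u ≤ (2 * √ (1 + δ) * ε + √2 * δ * R) / (1 - δl) := by
    rcases hu0.eq_or_lt with h0 | h0
    · rw [← h0]; positivity
    · rw [le_div_iff₀ h1δ]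
      apply le_of_mul_le_mul_left _ h0
      linarith
  have htri : l2norm h ≤ l2norm u + l2norm t := by
    conv_lhs => rw [hsplit]
    exact l2norm_add _ _
  have hub2 : (2 * √ (1 + δ) * ε + √2 * δ * R) / (1 - δl) ≤
      (2 * √ (1 + δ) * ε + √2 * δ * (2 * (σ / √ s))) / (1 - δl) := by
    gcongr
  calc l2norm h ≤ (2 * √ (1 + δ) * ε + √2 * δ * (2 * (σ / √ s))) / (1 - δl)
        + 2 * (σ / √ s) := by linarith
    _ = _ := by ring
end

section
/- Let k ≥ 1 be an integer and suppose A ∈ ℝ^{m×n} satisfies the order-2k RIP with symmetric constant δ_{2k} < √2 − 1 (that is, (1−δ_{2k})‖z‖₂² ≤ ‖Az‖₂² ≤ (1+δ_{2k})‖z‖₂² for all z with at most 2k nonzero entries). Then for every x ∈ ℝⁿ and every w ∈ ℝ^m with ‖w‖₂ ≤ ε, any solution ẑ of the ℓ₁-minimization problem min_{z ∈ ℝⁿ} ‖z‖₁ subject to ‖Az − y‖₂ ≤ ε, with y = Ax + w, satisfies ‖ẑ − x‖₂ ≤ C₁ ε + C₂ ‖x_{S^c}‖₁ / √k, where S is a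 set of k indices of the largest-magnitude entries of x, C₁ = 4√(1+δ_{2k}) / (1 − (√2+1)δ_{2k}), and C₂ = 4√2 δ_{2k} / (1 − (√2+1)δ_{2k}) + 2. -/
open scoped BigOperators

noncomputable def res5 {n : ℕ} (T : Finset (Fin n)) (h : Fin n → ℝ) : Fin n → ℝ :=
  fun i => if i ∈ T then h i else 0

lemma res5_sq {n : ℕ} (T : Finset (Fin n)) (h : Fin n → ℝ) :
    ∑ i, res5 T h i ^ 2 = ∑ i ∈ T, h i ^ 2 := by
  simp [res5, ite_pow, Finset.sum_ite_mem]

lemma res5_union {n : ℕ} (B R : Finset (Fin n)) (hd : Disjoint B R) (h : Fin n → ℝ) :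
    res5 (B ∪ R) h = res5 B h + res5 R h := by
  funext i
  have hdi := fun hb => Finset.disjoint_left.1 hd (show i ∈ _ from hb)
  by_cases h1 : i ∈ B <;> by_cases h2 : i ∈ R <;> simp_all [res5]

lemma tri5 {n : ℕ} (a b : Fin n → ℝ) : l2norm (a + b) ≤ l2norm a + l2norm b := by
  have h := norm_add_le (WithLp.toLp 2 a : EuclideanSpace ℝ (Fin n)) (WithLp.toLp 2 b)
  simpa [EuclideanSpace.norm_eq, l2norm] using h

lemma cs5 {n : ℕ} (a b : Fin n → ℝ) : |a ⬝ᵥ b| ≤ l2norm a * l2norm b := by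
  have h := Finset.sum_mul_sq_le_sq_mul_sq Finset.univ a b
  unfold l2norm
  rw [← Real.sqrt_mul (Finset.sum_nonneg fun i _ => sq_nonneg _)]
  exact Real.abs_le_sqrt h

lemma dot5 {n : ℕ} (a : Fin n → ℝ) : a ⬝ᵥ a = ∑ i, a i ^ 2 := by
  simp [dotProduct, sq]

/-- top-k selection -/
lemma top5 {n : ℕ} (h : Fin n → ℝ) (k : ℕ) : ∀ R : Finset (Fin n), k ≤ R.card →
    ∃ B ⊆ R, B.card = k ∧ ∀ i ∈ B, ∀ j ∈ R \ B, |h j| ≤ |h i| := by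
  induction k with
  | zero => intro R _; exact ⟨∅, by simp, by simp, by simp⟩
  | succ k ih =>
    intro R hR
    obtain ⟨B, hB, hc, hm⟩ := ih R (by omega)
    have hne : (R \ B).Nonempty := by
      rw [← Finset.card_pos, Finset.card_sdiff_of_subset hB]; omega
    obtain ⟨t, ht, htm⟩ := Finset.exists_max_image (R \ B) (fun i => |h i|) hne
    have ht' := Finset.mem_sdiff.1 ht
    refine ⟨insert t B, Finset.insert_subset ht'.1 hB, by
      rw [Finset.card_insert_of_notMem ht'.2, hc], ?_⟩
    intro i hi j hj
    have hj' : j ∈ R \ B := by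
      simp only [Finset.mem_sdiff, Finset.mem_insert, not_or] at hj ⊢
      exact ⟨hj.1, hj.2.2⟩
    rcases Finset.mem_insert.1 hi with rfl | hi
    · exact htm j hj'
    · exact hm i hi j hj'

/-- top block with a threshold -/
lemma blk5 {n : ℕ} (h : Fin n → ℝ) (k : ℕ) (hk : 1 ≤ k) (R : Finset (Fin n)) :
    ∃ B ⊆ R, B.card ≤ k ∧ (R.Nonempty → B.Nonempty) ∧ ∃ M : ℝ, 0 ≤ M ∧
      (∀ j ∈ R \ B, |h j| ≤ M) ∧ Real.sqrt k * M ≤ (∑ i ∈ B, |h i|) / Real.sqrt k := by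
  have hk0 : (0 : ℝ) < k := by exact_mod_cast hk
  have hs : 0 < Real.sqrt k := Real.sqrt_pos.2 hk0
  rcases le_total R.card k with hc | hc
  · refine ⟨R, subset_rfl, hc, id, 0, le_rfl, by simp, ?_⟩
    have : 0 ≤ ∑ i ∈ R, |h i| := Finset.sum_nonneg fun i _ => abs_nonneg _
    rw [mul_zero]; positivity
  · obtain ⟨B, hB, hBc, hm⟩ := top5 h k R hc
    have hne : B.Nonempty := by rw [← Finset.card_pos]; omega
    obtain ⟨t, ht, htm⟩ := Finset.exists_min_image B (fun i => |h i|) hne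
    refine ⟨B, hB, hBc.le, fun _ => hne, |h t|, abs_nonneg _, fun j hj => hm t ht j hj, ?_⟩
    have h1 := Finset.card_nsmul_le_sum B (fun i => |h i|) _ htm
    rw [le_div_iff₀ hs]
    rw [hBc, nsmul_eq_mul] at h1
    calc _ = (Real.sqrt k * Real.sqrt k) * |h t| := by ring
      _ ≤ _ := by rw [Real.mul_self_sqrt hk0.le]; exact h1

lemma sum5 {n : ℕ} (h : Fin n → ℝ) (k : ℕ) (hk : 1 ≤ k) (c : ℝ) (hc : 0 ≤ c)
    (F : Finset (Fin n) → ℝ) (R0 : Finset (Fin n)) (hF0 : F ∅ ≤ 0)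
    (hF : ∀ B R, Disjoint B R → F (B ∪ R) ≤ F B + F R)
    (hFB : ∀ B ⊆ R0, B.card ≤ k → F B ≤ c * Real.sqrt (∑ i ∈ B, h i ^ 2)) :
    ∀ (N : ℕ) (R : Finset (Fin n)), R.card ≤ N → R ⊆ R0 → ∀ M : ℝ, 0 ≤ M → (∀ i ∈ R, |h i| ≤ M) →
      F R ≤ c * (Real.sqrt k * M + (∑ i ∈ R, |h i|) / Real.sqrt k) := by
  intro N
  induction N with
  | zero =>
    intro R hR _ M hM _
    have : R = ∅ := by simpa using hR
    subst this
    have : 0 ≤ c * (Real.sqrt k * M) := by positivity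
    simpa using hF0.trans this
  | succ N ih =>
    intro R hRc hR M hM hh
    rcases R.eq_empty_or_nonempty with rfl | hne
    · have : 0 ≤ c * (Real.sqrt k * M) := by positivity
      simpa using hF0.trans this
    obtain ⟨B, hB, hBc, hBne, m, hm, hmR, hmB⟩ := blk5 h k hk R
    have hBp := Finset.card_pos.2 (hBne hne)
    have h1 := ih (R \ B) (by rw [Finset.card_sdiff_of_subset hB]; omega)
      (Finset.sdiff_subset.trans hR) m hm hmR
    have h2 := hFB B (hB.trans hR) hBc
    have h3 := hF B (R \ B) Finset.disjoint_sdiff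
    rw [Finset.union_sdiff_of_subset hB] at h3
    have h4 : Real.sqrt (∑ i ∈ B, h i ^ 2) ≤ Real.sqrt k * M := by
      apply Real.sqrt_le_iff.2 ⟨by positivity, ?_⟩
      rw [mul_pow, Real.sq_sqrt (by positivity)]
      have : ∑ i ∈ B, h i ^ 2 ≤ B.card • M ^ 2 := by
        apply Finset.sum_le_card_nsmul
        intro i hi
        rw [← sq_abs]
        exact pow_le_pow_left₀ (abs_nonneg _) (hh i (hB hi)) 2
      refine this.trans ?_
      rw [nsmul_eq_mul]
      have : (B.card : ℝ) ≤ k := by exact_mod_cast hBc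
      gcongr
    have h5 : ∑ i ∈ R, |h i| = ∑ i ∈ R \ B, |h i| + ∑ i ∈ B, |h i| :=
      (Finset.sum_sdiff hB).symm
    calc F R ≤ F B + F (R \ B) := h3
      _ ≤ c * (Real.sqrt k * M) + c * (Real.sqrt k * m + (∑ i ∈ R \ B, |h i|) / Real.sqrt k) :=
        add_le_add (h2.trans (mul_le_mul_of_nonneg_left h4 hc)) h1
      _ ≤ c * (Real.sqrt k * M) + c * ((∑ i ∈ B, |h i|) / Real.sqrt k
            + (∑ i ∈ R \ B, |h i|) / Real.sqrt k) := by gcongr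
      _ = _ := by rw [h5]; ring

lemma rip5 {m n : ℕ} (A : Matrix (Fin m) (Fin n) ℝ) (k : ℕ) (δ : ℝ) (hδ0 : 0 < δ)
    (hRIP : ∀ z : Fin n → ℝ, Sparse (2 * k) z →
      (1 - δ) * (∑ i, z i ^ 2) ≤ (∑ i, A.mulVec z i ^ 2) ∧
        (∑ i, A.mulVec z i ^ 2) ≤ (1 + δ) * (∑ i, z i ^ 2))
    (h : Fin n → ℝ) (U V : Finset (Fin n)) (hU : U.card ≤ k) (hV : V.card ≤ k)
    (hd : Disjoint U V) :
    |A.mulVec (res5 U h) ⬝ᵥ A.mulVec (res5 V h)| ≤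
      δ * Real.sqrt (∑ i ∈ U, h i ^ 2) * Real.sqrt (∑ i ∈ V, h i ^ 2) := by
  set u := res5 U h with hu
  set v := res5 V h with hv
  have huv : u ⬝ᵥ v = 0 := by
    apply Finset.sum_eq_zero
    intro i _
    have hdi := fun hb => Finset.disjoint_left.1 hd (show i ∈ _ from hb)
    by_cases h1 : i ∈ U <;> by_cases h2 : i ∈ V <;> simp_all [res5]
  have hsp : ∀ t : ℝ, Sparse (2 * k) (u + t • v) := by
    intro t
    refine ⟨U ∪ V, (Finset.card_union_le _ _).trans (by omega), ?_⟩
    intro i hi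
    simp only [Finset.mem_union, not_or] at hi
    simp [hu, hv, res5, hi.1, hi.2]
  have key : ∀ t : ℝ, 0 ≤ (δ * (v ⬝ᵥ v)) * (t * t) +
      (-2 * (A.mulVec u ⬝ᵥ A.mulVec v)) * t + δ * (u ⬝ᵥ u) := by
    intro t
    have h1 := (hRIP _ (hsp t)).2
    have h2 := (hRIP _ (hsp (-t))).1
    rw [← dot5, ← dot5] at h1 h2
    have hc := dotProduct_comm v u
    have hc' := dotProduct_comm (A.mulVec v) (A.mulVec u)
    simp only [Matrix.mulVec_add, Matrix.mulVec_smul, add_dotProduct, dotProduct_add,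
      smul_dotProduct, dotProduct_smul, smul_eq_mul, hc, hc', huv] at h1 h2
    nlinarith
  have hdis := discrim_le_zero key
  rw [discrim, dot5, dot5, hu, hv, res5_sq, res5_sq] at hdis
  have : (A.mulVec u ⬝ᵥ A.mulVec v)^2 ≤
      (δ * Real.sqrt (∑ i ∈ U, h i ^ 2) * Real.sqrt (∑ i ∈ V, h i ^ 2))^2 := by
    rw [mul_pow, mul_pow, Real.sq_sqrt (Finset.sum_nonneg fun i _ => sq_nonneg _),
      Real.sq_sqrt (Finset.sum_nonneg fun i _ => sq_nonneg _)]
    nlinarith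
  exact abs_le_of_sq_le_sq this (by positivity)

theorem stmt5 {m n : ℕ} (A : Matrix (Fin m) (Fin n) ℝ)
    (k : ℕ) (hk : 1 ≤ k) (δ : ℝ) (hδ0 : 0 < δ) (hδ : δ < Real.sqrt 2 - 1)
    -- order-2k RIP with symmetric constant δ
    (hRIP : ∀ z : Fin n → ℝ, Sparse (2 * k) z →
      (1 - δ) * (∑ i, z i ^ 2) ≤ (∑ i, A.mulVec z i ^ 2) ∧
        (∑ i, A.mulVec z i ^ 2) ≤ (1 + δ) * (∑ i, z i ^ 2))
    (ε : ℝ) (x : Fin n → ℝ) (w : Fin m → ℝ) (hw : l2norm w ≤ ε)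
    (y : Fin m → ℝ) (hy : y = A.mulVec x + w)
    -- `S` is a set of `k` indices of the largest-magnitude entries of `x`
    (S : Finset (Fin n)) (hScard : S.card = k)
    (hSmax : ∀ i ∈ S, ∀ j ∉ S, |x j| ≤ |x i|)
    -- `zhat` is a solution of the ℓ₁ minimization problem
    (zhat : Fin n → ℝ)
    (hfeas : l2norm (A.mulVec zhat - y) ≤ ε)
    (hopt : ∀ z : Fin n → ℝ, l2norm (A.mulVec z - y) ≤ ε →
      (∑ i, |zhat i|) ≤ ∑ i, |z i|) :
    l2norm (zhat - x) ≤
      4 * Real.sqrt (1 + δ) / (1 - (Real.sqrt 2 + 1) * δ) * ε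
        + (4 * Real.sqrt 2 * δ / (1 - (Real.sqrt 2 + 1) * δ) + 2)
          * (l1normOn Sᶜ x / Real.sqrt k) := by
  have hk0 : (0 : ℝ) < k := by exact_mod_cast hk
  have hs : 0 < Real.sqrt k := Real.sqrt_pos.2 hk0
  obtain ⟨h, hh⟩ : ∃ h, h = zhat - x := ⟨_, rfl⟩
  rw [← hh]
  -- tube constraint
  have htube : l2norm (A.mulVec h) ≤ 2 * ε := by
    have : A.mulVec h = (A.mulVec zhat - y) + w := by
      rw [hh, hy, Matrix.mulVec_sub]; abel
    rw [this]
    linarith [tri5 (A.mulVec zhat - y) w]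
  -- cone constraint
  have hcone : ∑ i ∈ Sᶜ, |h i| ≤ ∑ i ∈ S, |h i| + 2 * l1normOn Sᶜ x := by
    have h1 := hopt x (by
      have : A.mulVec x - y = -w := by rw [hy]; abel
      rw [this]; simpa [l2norm] using hw)
    rw [← Finset.sum_add_sum_compl S, ← Finset.sum_add_sum_compl S (fun i => |x i|)] at h1
    have h2 : ∑ i ∈ S, |x i| ≤ ∑ i ∈ S, |zhat i| + ∑ i ∈ S, |h i| := by
      rw [← Finset.sum_add_distrib]
      refine Finset.sum_le_sum fun i _ => ?_
      have := abs_sub (zhat i) (h i)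
      simpa [hh] using this
    have h3 : ∑ i ∈ Sᶜ, |h i| ≤ ∑ i ∈ Sᶜ, |zhat i| + ∑ i ∈ Sᶜ, |x i| := by
      rw [← Finset.sum_add_distrib]
      refine Finset.sum_le_sum fun i _ => ?_
      have := abs_sub (zhat i) (x i)
      simpa [hh] using this
    unfold l1normOn
    linarith
  obtain ⟨T, hT, hTc, -, M, hM, hMR, hMT⟩ := blk5 h k hk Sᶜ
  set R := Sᶜ \ T with hR
  have hST : Disjoint S T := Finset.disjoint_left.2 fun i hi hi' => by
    simpa [hi] using hT hi'
  have hSTR : Disjoint (S ∪ T) R := Finset.disjoint_left.2 fun i hi hi' => by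
    simp [hR] at hi hi'; tauto
  have huniv : (S ∪ T) ∪ R = Finset.univ := by
    ext i; simp [hR]; tauto
  have hSR : Disjoint S R := hSTR.mono_left Finset.subset_union_left
  have hTR : Disjoint T R := hSTR.mono_left Finset.subset_union_right
  obtain ⟨Q, hQ⟩ : ∃ Q, Q = (∑ i ∈ Sᶜ, |h i|) / Real.sqrt k := ⟨_, rfl⟩
  have hQ0 : 0 ≤ Q := by rw [hQ]; positivity
  have hQb : Real.sqrt k * M + (∑ i ∈ R, |h i|) / Real.sqrt k ≤ Q := by
    rw [hQ, ← Finset.sum_sdiff hT, add_div]; linarith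
  -- the tail
  have hres0 : res5 (∅ : Finset (Fin n)) h = 0 := by funext i; simp [res5]
  have htail : l2norm (res5 R h) ≤ Q := by
    have := sum5 h k hk 1 zero_le_one (fun R => l2norm (res5 R h)) R
      (by simp [hres0, l2norm])
      (fun B R hd => by simp only [res5_union B R hd]; exact tri5 _ _)
      (fun B _ _ => by simp [l2norm, res5_sq]) R.card R le_rfl subset_rfl M hM hMR
    rw [one_mul] at this
    exact this.trans hQb
  have hinner : ∀ U : Finset (Fin n), U.card ≤ k → Disjoint U R →
      |A.mulVec (res5 U h) ⬝ᵥ A.mulVec (res5 R h)| ≤ δ * Real.sqrt (∑ i ∈ U, h i ^ 2) * Q := by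
    intro U hU hUR
    have := sum5 h k hk (δ * Real.sqrt (∑ i ∈ U, h i ^ 2)) (by positivity)
      (fun R => |A.mulVec (res5 U h) ⬝ᵥ A.mulVec (res5 R h)|) R
      (by simp [hres0])
      (fun B R hd => by
        simp only [res5_union B R hd, Matrix.mulVec_add, dotProduct_add]; exact abs_add_le _ _)
      (fun B hB hBc => rip5 A k δ hδ0 hRIP h U B hU hBc (hUR.mono_right hB))
      R.card R le_rfl subset_rfl M hM hMR
    exact this.trans (mul_le_mul_of_nonneg_left hQb (by positivity))
  have hiS := hinner S hScard.le hSR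
  have hiT := hinner T hTc hTR
  obtain ⟨p, hp⟩ : ∃ p, p = Real.sqrt (∑ i ∈ S, h i ^ 2) := ⟨_, rfl⟩
  obtain ⟨q, hq⟩ : ∃ q, q = Real.sqrt (∑ i ∈ T, h i ^ 2) := ⟨_, rfl⟩
  obtain ⟨a, ha⟩ : ∃ a, a = l2norm (res5 (S ∪ T) h) := ⟨_, rfl⟩
  rw [← hp] at hiS
  rw [← hq] at hiT
  have hp0 : 0 ≤ p := by rw [hp]; positivity
  have hq0 : 0 ≤ q := by rw [hq]; positivity
  have ha0 : 0 ≤ a := by rw [ha]; exact Real.sqrt_nonneg _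
  have hasq : a ^ 2 = ∑ i, res5 (S ∪ T) h i ^ 2 := by
    rw [ha, l2norm, Real.sq_sqrt (Finset.sum_nonneg fun i _ => sq_nonneg _)]
  have hpq : a ^ 2 = p ^ 2 + q ^ 2 := by
    rw [hasq, res5_sq, Finset.sum_union hST, hp, hq,
      Real.sq_sqrt (Finset.sum_nonneg fun i _ => sq_nonneg _),
      Real.sq_sqrt (Finset.sum_nonneg fun i _ => sq_nonneg _)]
  have hpa : p ≤ a := by nlinarith
  have hs2 : Real.sqrt 2 ^ 2 = 2 := Real.sq_sqrt (by norm_num)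
  have hs20 : 0 ≤ Real.sqrt 2 := Real.sqrt_nonneg _
  have hpqa : p + q ≤ Real.sqrt 2 * a := by
    refine (pow_le_pow_iff_left₀ (by positivity) (by positivity) two_ne_zero).1 ?_
    rw [mul_pow, hs2, hpq]; nlinarith [sq_nonneg (p - q)]
  -- ℓ₁ vs ℓ₂ on S
  have hl1 : (∑ i ∈ S, |h i|) / Real.sqrt k ≤ p := by
    rw [div_le_iff₀ hs, hp, ← Real.sqrt_mul (Finset.sum_nonneg fun i _ => sq_nonneg _)]
    apply Real.le_sqrt_of_sq_le
    have := sq_sum_le_card_mul_sum_sq (s := S) (f := fun i => |h i|)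
    simp only [sq_abs, hScard] at this
    linarith
  obtain ⟨e, he⟩ : ∃ e, e = l1normOn Sᶜ x / Real.sqrt k := ⟨_, rfl⟩
  rw [← he]
  have hQe : Q ≤ a + 2 * e := by
    have : Q ≤ (∑ i ∈ S, |h i| + 2 * l1normOn Sᶜ x) / Real.sqrt k := by
      rw [hQ]; gcongr
    rw [add_div, mul_div_assoc, ← he] at this
    linarith
  have hdec : h = res5 (S ∪ T) h + res5 R h := by
    rw [← res5_union _ _ hSTR, huniv]; funext i; simp [res5]
  have hhle : l2norm h ≤ a + Q := by
    have := tri5 (res5 (S ∪ T) h) (res5 R h)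
    rw [← hdec, ← ha] at this
    linarith
  have hrip := hRIP (res5 (S ∪ T) h) ⟨S ∪ T, (Finset.card_union_le _ _).trans (by omega),
    fun i hi => by simp only [res5, if_neg hi]⟩
  rw [← hasq] at hrip
  have hAa : l2norm (A.mulVec (res5 (S ∪ T) h)) ≤ Real.sqrt (1 + δ) * a := by
    rw [← Real.sqrt_sq ha0, ← Real.sqrt_mul (by linarith)]
    exact Real.sqrt_le_sqrt hrip.2
  have hε : 0 ≤ ε := (Real.sqrt_nonneg _).trans hw
  have hmain : (1 - δ) * a ^ 2 ≤ Real.sqrt (1 + δ) * a * (2 * ε) + δ * (Real.sqrt 2 * a) * Q := by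
    have e1 := hrip.1
    rw [← dot5] at e1
    have e2 : A.mulVec (res5 (S ∪ T) h) ⬝ᵥ A.mulVec h =
        A.mulVec (res5 (S ∪ T) h) ⬝ᵥ A.mulVec (res5 (S ∪ T) h) +
        (A.mulVec (res5 S h) ⬝ᵥ A.mulVec (res5 R h) +
          A.mulVec (res5 T h) ⬝ᵥ A.mulVec (res5 R h)) := by
      rw [← add_dotProduct, ← Matrix.mulVec_add, ← res5_union S T hST, ← dotProduct_add,
        ← Matrix.mulVec_add, ← hdec]
    have e3 := (le_abs_self _).trans (cs5 (A.mulVec (res5 (S ∪ T) h)) (A.mulVec h))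
    have e4 : l2norm (A.mulVec (res5 (S ∪ T) h)) * l2norm (A.mulVec h) ≤
        Real.sqrt (1 + δ) * a * (2 * ε) :=
      mul_le_mul hAa htube (Real.sqrt_nonneg _) (by positivity)
    have e5 : δ * (p + q) * Q ≤ δ * (Real.sqrt 2 * a) * Q := by gcongr
    have e6 := neg_abs_le (A.mulVec (res5 S h) ⬝ᵥ A.mulVec (res5 R h))
    have e7 := neg_abs_le (A.mulVec (res5 T h) ⬝ᵥ A.mulVec (res5 R h))
    linarith
  have he0 : 0 ≤ e := by
    rw [he]; unfold l1normOn; positivity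
  have hD : 0 < 1 - (Real.sqrt 2 + 1) * δ := by nlinarith
  have hlin : (1 - δ) * a ≤ 2 * Real.sqrt (1 + δ) * ε + Real.sqrt 2 * δ * Q := by
    rcases ha0.eq_or_lt with h0 | h0
    · rw [← h0, mul_zero]; positivity
    · refine le_of_mul_le_mul_right ?_ h0
      linarith
  have hfin : a ≤ (2 * Real.sqrt (1 + δ) * ε + 2 * Real.sqrt 2 * δ * e) /
      (1 - (Real.sqrt 2 + 1) * δ) := by
    rw [le_div_iff₀ hD]
    have : Real.sqrt 2 * δ * Q ≤ Real.sqrt 2 * δ * (a + 2 * e) := by gcongr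
    linarith
  calc l2norm h ≤ 2 * a + 2 * e := by linarith
    _ ≤ 2 * ((2 * Real.sqrt (1 + δ) * ε + 2 * Real.sqrt 2 * δ * e) /
      (1 - (Real.sqrt 2 + 1) * δ)) + 2 * e := by linarith
    _ = _ := by ring
end

section
/- Let T ⊆ {1,…,n} with |T| = k_T, let k ≥ 1 be an integer, let a > 0, set K = max{(a+1)k + k_T, 2ak} and γ = √((1 + k_T/k)/a). Suppose A ∈ ℝ^{m×n} satisfies the order-K RIP with symmetric constant δ_K (that is, (1−δ_K)‖z‖₂² ≤ ‖Az‖₂² ≤ (1+δ_K)‖z‖₂² for all z with at most ⌈K⌉ nonzero entries) satisfying β := δ_K + 3√2 γ δ_K < 1. Then for every x ∈ ℝⁿ and every w ∈ ℝ^m, any solution ẑ of the tail-lasso problem min_z f(z) with y = Ax + w and λ > 2‖Aᵀw‖_∞ satisfies ‖ẑ − x‖₂ ≤ C₁ λ √(k + k_T) + C₂ √(λ ‖x_{T^c ∩ S₀^c}‖₁) + C₃ ‖x_{T^c ∩ S₀^c}‖₁ / √(ak), where S₀ ⊆ T^c is a set of k indices of the largest-magnitude entries of x_{T^c}, C₁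 = 6(1+δ_K)(3γ+1)/(1−β)², C₂ = 2√2 (3γ+1)/(1−β), and C₃ = 8δ_K(3γ+1)/(1−β) + 4. -/
open scoped BigOperators
open Matrix

/-- The ℓ∞ norm of a vector. -/
noncomputable def linfnorm {n : ℕ} (x : Fin n → ℝ) : ℝ := ‖x‖

/-- The tail-lasso objective `f(z) = ½‖Az − y‖₂² + λ‖z_{Tᶜ}‖₁`. -/
noncomputable def tailLasso {m n : ℕ} (A : Matrix (Fin m) (Fin n) ℝ) (y : Fin m → ℝ)
    (T : Finset (Fin n)) (lam : ℝ) (z : Fin n → ℝ) : ℝ :=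
  (∑ i, (A.mulVec z i - y i) ^ 2) / 2 + lam * l1normOn Tᶜ z

/-- restriction of a vector -/
def rst {n : ℕ} (B : Finset (Fin n)) (v : Fin n → ℝ) : Fin n → ℝ :=
  fun i => if i ∈ B then v i else 0

noncomputable def nn {n : ℕ} (B : Finset (Fin n)) (v : Fin n → ℝ) : ℝ :=
  Real.sqrt (∑ i ∈ B, v i ^ 2)

lemma nn_nonneg {n : ℕ} (B : Finset (Fin n)) (v : Fin n → ℝ) : 0 ≤ nn B v := Real.sqrt_nonneg _

lemma nn_sq {n : ℕ} (B : Finset (Fin n)) (v : Fin n → ℝ) : nn B v ^ 2 = ∑ i ∈ B, v i ^ 2 :=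
  Real.sq_sqrt (Finset.sum_nonneg fun _ _ => sq_nonneg _)

lemma l1_nonneg {n : ℕ} (B : Finset (Fin n)) (v : Fin n → ℝ) : 0 ≤ l1normOn B v :=
  Finset.sum_nonneg fun _ _ => abs_nonneg _

lemma l1_union {n : ℕ} {B C : Finset (Fin n)} (h : Disjoint B C) (v : Fin n → ℝ) :
    l1normOn (B ∪ C) v = l1normOn B v + l1normOn C v := Finset.sum_union h

lemma rst_sq {n : ℕ} (B : Finset (Fin n)) (v : Fin n → ℝ) :
    ∑ i, rst B v i ^ 2 = ∑ i ∈ B, v i ^ 2 := by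
  simp [rst, ite_pow, Finset.sum_ite_mem]

lemma rst_union {n : ℕ} {B C : Finset (Fin n)} (h : Disjoint B C) (v : Fin n → ℝ) :
    rst (B ∪ C) v = rst B v + rst C v := by
  funext i
  have := (fun hb => Finset.disjoint_left.mp h hb : i ∈ B → i ∉ C)
  by_cases h1 : i ∈ B <;> by_cases h2 : i ∈ C <;> simp_all [rst]

lemma block_bound_s6 {n : ℕ} (B : Finset (Fin n)) (v : Fin n → ℝ) (s : ℕ) (hs : 1 ≤ s)
    (hB : B.card = s) (m M : ℝ) (hm : 0 ≤ m) (hmM : m ≤ M)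
    (h1 : ∀ i ∈ B, m ≤ |v i|) (h2 : ∀ i ∈ B, |v i| ≤ M) :
    nn B v ≤ l1normOn B v / Real.sqrt s + Real.sqrt s * (M - m) / 4 := by
  have hs' : (0:ℝ) < s := by exact_mod_cast hs
  set q := Real.sqrt s with hq
  have hq0 : 0 < q := Real.sqrt_pos.mpr hs'
  have hq2 : q ^ 2 = s := Real.sq_sqrt hs'.le
  set L := l1normOn B v with hL
  have hL0 : 0 ≤ L := l1_nonneg B v
  apply Real.sqrt_le_iff.mpr
  refine ⟨by have := sub_nonneg.mpr hmM; positivity, ?_⟩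
  have hsum : ∑ i ∈ B, v i ^ 2 ≤ (M + m) * L - s * (M * m) := by
    have : ∑ i ∈ B, v i ^ 2 ≤ ∑ i ∈ B, ((M + m) * |v i| - M * m) := by
      apply Finset.sum_le_sum
      intro i hi
      nlinarith [mul_nonneg (sub_nonneg.mpr (h1 i hi)) (sub_nonneg.mpr (h2 i hi)), sq_abs (v i)]
    rw [Finset.sum_sub_distrib, ← Finset.mul_sum, Finset.sum_const, hB, nsmul_eq_mul] at this
    exact this
  refine hsum.trans ?_
  set μ := L / q ^ 2 with hμ
  have hLμ : L = μ * q ^ 2 := by rw [hμ]; field_simp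
  have e : L / q = μ * q := by rw [hLμ]; field_simp
  rw [e, hLμ, ← hq2]
  have key : 0 ≤ (μ + (M - m) / 4) ^ 2 - (M + m) * μ + M * m := by
    nlinarith [sq_nonneg (μ - (M + 3 * m) / 4), mul_nonneg hm (sub_nonneg.mpr hmM)]
  nlinarith [mul_nonneg (sq_nonneg q) key]

lemma flat_bound {n : ℕ} (B : Finset (Fin n)) (v : Fin n → ℝ) (s : ℕ) (hs : 1 ≤ s)
    (M : ℝ) (hM : 0 ≤ M) (h2 : ∀ i ∈ B, |v i| ≤ M) :
    nn B v ≤ l1normOn B v / Real.sqrt s + Real.sqrt s * M / 4 := by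
  have hs' : (0:ℝ) < s := by exact_mod_cast hs
  set q := Real.sqrt s with hq
  have hq0 : 0 < q := Real.sqrt_pos.mpr hs'
  set L := l1normOn B v with hL
  have hL0 : 0 ≤ L := l1_nonneg B v
  apply Real.sqrt_le_iff.mpr
  refine ⟨by positivity, ?_⟩
  have hsum : ∑ i ∈ B, v i ^ 2 ≤ M * L := by
    rw [hL, l1normOn, Finset.mul_sum]
    apply Finset.sum_le_sum
    intro i hi
    nlinarith [mul_nonneg (abs_nonneg (v i)) (sub_nonneg.mpr (h2 i hi)), sq_abs (v i)]
  refine hsum.trans ?_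
  have e : M * L = 4 * (L / q) * (q * M / 4) := by field_simp
  rw [e]
  nlinarith [sq_nonneg (L / q - q * M / 4)]

lemma exists_top {n : ℕ} (v : Fin n → ℝ) (U : Finset (Fin n)) (s : ℕ) (hsU : s ≤ U.card) :
    ∃ B ⊆ U, B.card = s ∧ ∀ i ∈ B, ∀ j ∈ U \ B, |v j| ≤ |v i| := by
  induction s with
  | zero => exact ⟨∅, by simp, by simp, by simp⟩
  | succ s ih =>
    obtain ⟨B, hBU, hBc, hB⟩ := ih (by omega)
    have hne : (U \ B).Nonempty := by
      rw [← Finset.card_pos, Finset.card_sdiff_of_subset hBU]; omega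
    obtain ⟨a, ha, hmax⟩ := Finset.exists_max_image (U \ B) (fun i => |v i|) hne
    have ha' := Finset.mem_sdiff.mp ha
    refine ⟨insert a B, ?_, ?_, ?_⟩
    · exact Finset.insert_subset ha'.1 hBU
    · rw [Finset.card_insert_of_notMem ha'.2, hBc]
    · intro i hi j hj
      have hj' : j ∈ U \ B := by
        simp only [Finset.mem_sdiff, Finset.mem_insert, not_or] at hj ⊢
        exact ⟨hj.1, hj.2.2⟩
      rcases Finset.mem_insert.mp hi with rfl | hi
      · exact hmax j hj'
      · exact hB i hi j hj'

lemma exists_top' {n : ℕ} (v : Fin n → ℝ) (U : Finset (Fin n)) (s : ℕ) (hs : 1 ≤ s)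
    (hsU : s ≤ U.card) :
    ∃ B ⊆ U, B.card = s ∧ ∃ m : ℝ, 0 ≤ m ∧ (∀ i ∈ B, m ≤ |v i|) ∧ (∀ j ∈ U \ B, |v j| ≤ m) ∧
      ∃ i ∈ B, m = |v i| := by
  obtain ⟨B, hBU, hBc, hB⟩ := exists_top v U s hsU
  obtain ⟨a, ha, hmin⟩ := Finset.exists_min_image B (fun i => |v i|)
    (Finset.card_pos.mp (by omega))
  exact ⟨B, hBU, hBc, |v a|, abs_nonneg _, hmin, hB a ha, a, ha, rfl⟩

lemma tail_bound_s6 {n : ℕ} (v : Fin n → ℝ) (s : ℕ) (hs : 1 ≤ s) (g : Finset (Fin n) → ℝ) (c : ℝ)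
    (hc : 0 ≤ c)
    (hsub : ∀ B C : Finset (Fin n), Disjoint B C → g (B ∪ C) ≤ g B + g C)
    (U0 : Finset (Fin n))
    (hg : ∀ B ⊆ U0, B.card ≤ s → g B ≤ c * nn B v) :
    ∀ (N : ℕ) (U : Finset (Fin n)) (M : ℝ), U ⊆ U0 → U.card ≤ N → 0 ≤ M → (∀ i ∈ U, |v i| ≤ M) →
      g U ≤ c * (l1normOn U v / Real.sqrt s + Real.sqrt s * M / 4) := by
  intro N
  induction N with
  | zero =>
    intro U M hU hN hM h
    exact (hg U hU (by omega)).trans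
      (mul_le_mul_of_nonneg_left (flat_bound U v s hs M hM h) hc)
  | succ N ih =>
    intro U M hU hN hM h
    by_cases hUs : U.card ≤ s
    · exact (hg U hU hUs).trans
        (mul_le_mul_of_nonneg_left (flat_bound U v s hs M hM h) hc)
    · obtain ⟨B, hBU, hBc, m, hm, h1, h2, a, ha, rfl⟩ := exists_top' v U s hs (by omega)
      have hb := block_bound_s6 B v s hs hBc _ M hm (h a (hBU ha)) h1 (fun i hi => h i (hBU hi))
      have hr := ih (U \ B) _ (Finset.sdiff_subset.trans hU)
        (by rw [Finset.card_sdiff_of_subset hBU]; omega) hm h2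
      have hd : Disjoint B (U \ B) := Finset.disjoint_sdiff
      have hu : B ∪ U \ B = U := Finset.union_sdiff_of_subset hBU
      have hs1 := hsub _ _ hd
      have hl := l1_union hd v
      rw [hu] at hs1 hl
      have hgB := (hg B (hBU.trans hU) hBc.le).trans (mul_le_mul_of_nonneg_left hb hc)
      rw [hl]
      calc g U ≤ _ := hs1.trans (add_le_add hgB hr)
        _ = _ := by ring

lemma scalar {X Z p q E : ℝ} (hp : 0 ≤ p) (hq : 0 ≤ q) (hE : 0 ≤ E) 
    (h1 : X ≤ Z + E) (h2 : Z ^ 2 ≤ p * X + q ^ 2) : X ≤ 2 * p + q + 1.4 * E := by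
  by_contra hcon
  push Not at hcon
  obtain ⟨t, ht, rfl⟩ : ∃ t, 0 < t ∧ X = 2 * p + q + 1.4 * E + t :=
    ⟨X - (2 * p + q + 1.4 * E), by linarith, by ring⟩
  have hZ : 2 * p + q + 0.4 * E + t ≤ Z := by linarith
  have h3 : (2 * p + q + 0.4 * E + t) ^ 2 ≤ Z ^ 2 := pow_le_pow_left₀ (by positivity) hZ 2
  nlinarith [mul_nonneg hp hq, mul_nonneg hp hE, mul_nonneg hq hE, mul_nonneg hp ht.le,
    mul_nonneg hq ht.le, mul_nonneg hE ht.le, sq_nonneg p, sq_nonneg E, mul_pos ht ht]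

lemma rip_inner_s6 {m n : ℕ} (A : Matrix (Fin m) (Fin n) ℝ) (κ : ℕ) (δ : ℝ) (hδ0 : 0 < δ)
    (hRIP : ∀ z : Fin n → ℝ, Sparse κ z →
      (1 - δ) * (∑ i, z i ^ 2) ≤ (∑ i, A.mulVec z i ^ 2) ∧
        (∑ i, A.mulVec z i ^ 2) ≤ (1 + δ) * (∑ i, z i ^ 2))
    (v : Fin n → ℝ) (B C : Finset (Fin n)) (hd : Disjoint B C) (hc : B.card + C.card ≤ κ) :
    |A.mulVec (rst B v) ⬝ᵥ A.mulVec (rst C v)| ≤ δ * nn B v * nn C v := by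
  set b := nn B v
  set c := nn C v
  set P := A.mulVec (rst B v) ⬝ᵥ A.mulVec (rst C v) with hP
  have hb : b ^ 2 = _ := nn_sq B v
  have hcc : c ^ 2 = _ := nn_sq C v
  have hb0 : 0 ≤ b := nn_nonneg B v
  have hc0 : 0 ≤ c := nn_nonneg C v
  have key : ∀ t : ℝ, 2 * t * P ≤ δ * (b ^ 2 + t ^ 2 * c ^ 2) := by
    intro t
    have hsp : ∀ t : ℝ, Sparse κ (rst B v + t • rst C v) := by
      intro t
      refine ⟨B ∪ C, (Finset.card_union_le _ _).trans hc, ?_⟩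
      intro i hi
      simp only [Finset.mem_union, not_or] at hi
      simp [rst, hi.1, hi.2]
    have hn : ∀ t : ℝ, ∑ i, (rst B v + t • rst C v) i ^ 2 = b ^ 2 + t ^ 2 * c ^ 2 := by
      intro t
      rw [hb, hcc, ← rst_sq B, ← rst_sq C, Finset.mul_sum, ← Finset.sum_add_distrib]
      apply Finset.sum_congr rfl
      intro i _
      have := (fun hb => Finset.disjoint_left.mp hd hb : i ∈ B → i ∉ C)
      by_cases h1 : i ∈ B <;> by_cases h2 : i ∈ C <;> simp_all [rst] <;> ring
    have hA : ∀ t : ℝ, ∑ i, A.mulVec (rst B v + t • rst C v) i ^ 2 =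
        ∑ i, A.mulVec (rst B v) i ^ 2 + 2 * t * P + t ^ 2 * ∑ i, A.mulVec (rst C v) i ^ 2 := by
      intro t
      rw [hP, dotProduct, Finset.mul_sum, Finset.mul_sum, ← Finset.sum_add_distrib,
        ← Finset.sum_add_distrib]
      apply Finset.sum_congr rfl
      intro i _
      rw [Matrix.mulVec_add, Matrix.mulVec_smul]
      simp only [Pi.add_apply, Pi.smul_apply, smul_eq_mul]
      ring
    have r1 := (hRIP _ (hsp t)).2
    have r2 := (hRIP _ (hsp (-t))).1
    rw [hn, hA] at r1 r2
    nlinarith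
  have h2 : P ^ 2 ≤ (δ * b * c) ^ 2 := by
    have hd := discrim_le_zero (a := δ * c ^ 2) (b := -2 * P) (c := δ * b ^ 2)
      (fun t => by nlinarith [key t])
    rw [discrim] at hd
    nlinarith
  exact abs_le_of_sq_le_sq h2 (by positivity)

lemma cs_l1 {n : ℕ} (B : Finset (Fin n)) (v : Fin n → ℝ) :
    l1normOn B v ≤ Real.sqrt B.card * nn B v := by
  rw [nn, ← Real.sqrt_mul (by positivity)]
  apply Real.le_sqrt_of_sq_le
  have := sq_sum_le_card_mul_sum_sq (s := B) (f := fun i => |v i|)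
  simpa [l1normOn] using this

lemma cs_dot {m : ℕ} (u v : Fin m → ℝ) :
    u ⬝ᵥ v ≤ Real.sqrt (∑ i, u i ^ 2) * Real.sqrt (∑ i, v i ^ 2) :=
  Real.sum_mul_le_sqrt_mul_sqrt _ _ _

lemma basic_ineq {m n : ℕ} (A : Matrix (Fin m) (Fin n) ℝ) (T S0 : Finset (Fin n))
    (hS0T : S0 ⊆ Tᶜ) (x : Fin n → ℝ) (w : Fin m → ℝ) (lam : ℝ)
    (hlam : lam > 2 * linfnorm (Aᵀ.mulVec w)) (zhat : Fin n → ℝ)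
    (hopt : tailLasso A (A.mulVec x + w) T lam zhat ≤ tailLasso A (A.mulVec x + w) T lam x) :
    ∑ i, A.mulVec (zhat - x) i ^ 2 + lam * l1normOn (Tᶜ \ S0) (zhat - x) ≤
      3 * lam * l1normOn (T ∪ S0) (zhat - x) + 4 * lam * l1normOn (Tᶜ \ S0) x := by
  set h := zhat - x with hh
  have hz : zhat = x + h := by rw [hh]; abel
  have hl0 : 0 ≤ lam := by
    have : 0 ≤ linfnorm (Aᵀ.mulVec w) := norm_nonneg _
    linarith
  have hdS : Disjoint S0 (Tᶜ \ S0) := Finset.disjoint_sdiff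
  have huS : S0 ∪ Tᶜ \ S0 = Tᶜ := Finset.union_sdiff_of_subset hS0T
  have hdT : Disjoint T S0 := by
    rw [Finset.disjoint_left]; intro i hi hi'
    exact Finset.mem_compl.mp (hS0T hi') hi
  -- the noise term
  have hnoise : A.mulVec h ⬝ᵥ w ≤ lam / 2 * ∑ i, |h i| := by
    have : A.mulVec h ⬝ᵥ w = h ⬝ᵥ Aᵀ.mulVec w := by
      rw [dotProduct_comm, Matrix.dotProduct_mulVec, dotProduct_comm, Matrix.mulVec_transpose]
    rw [this, dotProduct, Finset.mul_sum]
    apply Finset.sum_le_sum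
    intro i _
    have h1 : |Aᵀ.mulVec w i| ≤ linfnorm (Aᵀ.mulVec w) := norm_le_pi_norm (Aᵀ.mulVec w) i
    calc h i * Aᵀ.mulVec w i ≤ |h i * Aᵀ.mulVec w i| := le_abs_self _
      _ = |Aᵀ.mulVec w i| * |h i| := by rw [abs_mul, mul_comm]
      _ ≤ lam / 2 * |h i| := mul_le_mul_of_nonneg_right (by linarith) (abs_nonneg _)
  have hsplit : ∑ i, |h i| = l1normOn T h + l1normOn S0 h + l1normOn (Tᶜ \ S0) h := by
    rw [add_assoc, ← l1_union hdS, huS]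
    exact (Finset.sum_add_sum_compl T _).symm
  have hTS : l1normOn (T ∪ S0) h = l1normOn T h + l1normOn S0 h := l1_union hdT h
  have hx1 : l1normOn Tᶜ x = l1normOn S0 x + l1normOn (Tᶜ \ S0) x := by
    rw [← l1_union hdS, huS]
  have hz1 : l1normOn Tᶜ zhat = l1normOn S0 zhat + l1normOn (Tᶜ \ S0) zhat := by
    rw [← l1_union hdS, huS]
  have hz2 : l1normOn S0 x ≤ l1normOn S0 zhat + l1normOn S0 h := by
    simp only [l1normOn]; rw [← Finset.sum_add_distrib]
    apply Finset.sum_le_sum; intro i _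
    have : x i = zhat i - h i := by simp [hh]
    rw [this]; exact abs_sub _ _
  have hz3 : l1normOn (Tᶜ \ S0) h ≤ l1normOn (Tᶜ \ S0) zhat + l1normOn (Tᶜ \ S0) x := by
    simp only [l1normOn]; rw [← Finset.sum_add_distrib]
    apply Finset.sum_le_sum; intro i _
    exact abs_sub _ _
  have hobj : ∑ i, (A.mulVec zhat i - (A.mulVec x + w) i) ^ 2 =
      ∑ i, A.mulVec h i ^ 2 - 2 * (A.mulVec h ⬝ᵥ w) +
        ∑ i, (A.mulVec x i - (A.mulVec x + w) i) ^ 2 := by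
    rw [dotProduct, Finset.mul_sum, ← Finset.sum_sub_distrib, ← Finset.sum_add_distrib]
    apply Finset.sum_congr rfl; intro i _
    rw [hz, Matrix.mulVec_add]; simp only [Pi.add_apply]; ring
  unfold tailLasso at hopt
  rw [hobj, hx1, hz1] at hopt
  rw [hsplit] at hnoise
  rw [hTS]
  have hT0 := mul_nonneg hl0 (l1_nonneg T h)
  have m2 := mul_le_mul_of_nonneg_left hz2 hl0
  have m3 := mul_le_mul_of_nonneg_left hz3 hl0
  linarith

lemma sizes (r k : ℕ) (kT : ℕ) (hk : 1 ≤ k) (hr : r = kT + k) (a : ℝ) (ha : 0 < a)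
    (K : ℝ) (hK : K = max ((a + 1) * k + kT) (2 * a * k)) :
    ∃ s s1 : ℕ, 1 ≤ s ∧ 1 ≤ s1 ∧ a * k ≤ s ∧ s ≤ 4 * s1 ∧ r + s ≤ Nat.ceil K ∧
      s1 + s ≤ Nat.ceil K ∧ r + s1 ≤ Nat.ceil K := by
  have hk' : (0:ℝ) < k := by exact_mod_cast hk
  have hak : 0 < a * k := by positivity
  set q := a * k with hq
  have c1 : Nat.ceil (q + (r:ℕ)) ≤ Nat.ceil K := by
    apply Nat.ceil_mono; rw [hK]
    refine le_trans (le_of_eq ?_) (le_max_left _ _)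
    rw [hr, hq]; push_cast; ring
  have c2 : Nat.ceil (2 * q) ≤ Nat.ceil K := by
    apply Nat.ceil_mono; rw [hK]
    refine le_trans (le_of_eq ?_) (le_max_right _ _)
    rw [hq]; ring
  rw [Nat.ceil_add_natCast hak.le] at c1
  have hs : 1 ≤ Nat.ceil q := Nat.one_le_ceil_iff.mpr hak
  have hfc : Nat.floor q ≤ Nat.ceil q := Nat.floor_le_ceil q
  have hcf : Nat.ceil q ≤ Nat.floor q + 1 := Nat.ceil_le_floor_add_one q
  have hsum : Nat.floor q + Nat.ceil q ≤ Nat.ceil (2 * q) := by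
    by_contra hcon
    push Not at hcon
    have h1 : Nat.ceil (2 * q) ≤ Nat.floor q + Nat.ceil q - 1 := by omega
    have h2 := Nat.ceil_le.mp h1
    have h3 : Nat.ceil q - 1 < Nat.ceil q := by omega
    have h4 := Nat.lt_ceil.mp h3
    have h5 := Nat.floor_le hak.le
    have h6 : Nat.floor q + Nat.ceil q - 1 = Nat.floor q + (Nat.ceil q - 1) := by omega
    rw [h6] at h2
    push_cast at h2
    linarith
  exact ⟨Nat.ceil q, max 1 (Nat.floor q), hs, le_max_left _ _, Nat.le_ceil q, by omega, by omega,
    by omega, by omega⟩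

set_option maxHeartbeats 2000000

theorem stmt6 {m n : ℕ} (A : Matrix (Fin m) (Fin n) ℝ)
    (T : Finset (Fin n)) (kT : ℕ) (hkT : T.card = kT)
    (k : ℕ) (hk : 1 ≤ k) (a : ℝ) (ha : 0 < a)
    (K : ℝ) (hK : K = max ((a + 1) * k + kT) (2 * a * k))
    (γ : ℝ) (hγ : γ = Real.sqrt ((1 + (kT : ℝ) / k) / a))
    (δ : ℝ) (hδ0 : 0 < δ)
    -- order-K RIP with symmetric constant δ
    (hRIP : ∀ z : Fin n → ℝ, Sparse (Nat.ceil K) z →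
      (1 - δ) * (∑ i, z i ^ 2) ≤ (∑ i, A.mulVec z i ^ 2) ∧
        (∑ i, A.mulVec z i ^ 2) ≤ (1 + δ) * (∑ i, z i ^ 2))
    (β : ℝ) (hβ : β = δ + 3 * Real.sqrt 2 * γ * δ) (hβ1 : β < 1)
    (x : Fin n → ℝ) (w : Fin m → ℝ) (y : Fin m → ℝ) (hy : y = A.mulVec x + w)
    (lam : ℝ) (hlam : lam > 2 * linfnorm (Aᵀ.mulVec w))
    -- `S₀ ⊆ Tᶜ` is a set of `k` indices of the largest-magnitude entries of `x` on `Tᶜ`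
    (S0 : Finset (Fin n)) (hS0T : S0 ⊆ Tᶜ) (hS0card : S0.card = k)
    (hS0max : ∀ i ∈ S0, ∀ j ∈ Tᶜ \ S0, |x j| ≤ |x i|)
    -- `zhat` is a solution of the tail-lasso problem
    (zhat : Fin n → ℝ)
    (hopt : ∀ z : Fin n → ℝ, tailLasso A y T lam zhat ≤ tailLasso A y T lam z) :
    l2norm (zhat - x) ≤
      6 * (1 + δ) * (3 * γ + 1) / (1 - β) ^ 2 * (lam * Real.sqrt ((k : ℝ) + kT))
        + 2 * Real.sqrt 2 * (3 * γ + 1) / (1 - β)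
          * Real.sqrt (lam * l1normOn (Tᶜ \ S0) x)
        + (8 * δ * (3 * γ + 1) / (1 - β) + 4) * (l1normOn (Tᶜ \ S0) x / Real.sqrt (a * k)) := by
  subst hy
  set h := zhat - x with hh
  set S := T ∪ S0 with hS
  set V := Tᶜ \ S0 with hV
  have hbasic := basic_ineq A T S0 hS0T x w lam hlam zhat (hopt x)
  rw [← hh, ← hS, ← hV] at hbasic
  have hl0 : 0 < lam := by
    have : 0 ≤ linfnorm (Aᵀ.mulVec w) := norm_nonneg _
    linarith
  have hdT : Disjoint T S0 := by
    rw [Finset.disjoint_left]; intro i hi hi'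
    exact Finset.mem_compl.mp (hS0T hi') hi
  have hScard : S.card = kT + k := by
    rw [hS, Finset.card_union_of_disjoint hdT, hkT, hS0card]
  have hSV : Disjoint S V := by
    rw [Finset.disjoint_left]; intro i hi hi'
    simp only [hS, hV, Finset.mem_union, Finset.mem_sdiff, Finset.mem_compl] at hi hi'
    tauto
  have hSVu : S ∪ V = Finset.univ := by
    ext i
    simp only [hS, hV, Finset.mem_union, Finset.mem_sdiff, Finset.mem_compl, Finset.mem_univ]
    tauto
  obtain ⟨s, s1, hs, hs1, hsak, hss1, z1, z2, z3⟩ := sizes S.card k kT hk hScard a ha K hK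
  have hk' : (0:ℝ) < k := by exact_mod_cast hk
  have hak : 0 < a * k := by positivity
  have hs' : (0:ℝ) < s := by exact_mod_cast hs
  have hs1' : (0:ℝ) < s1 := by exact_mod_cast hs1
  -- first block
  obtain ⟨T1, hT1V, hT1c, M, hM0, hM, hMs⟩ : ∃ T1 ⊆ V, T1.card ≤ s1 ∧ ∃ M : ℝ, 0 ≤ M ∧
      (∀ j ∈ V \ T1, |h j| ≤ M) ∧ s1 * M ≤ l1normOn T1 h := by
    by_cases hc : V.card ≤ s1
    · exact ⟨V, subset_rfl, hc, 0, le_rfl, by simp, by simpa using l1_nonneg V h⟩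
    · obtain ⟨B, hBU, hBc, m, hm, h1, h2, -⟩ := exists_top' h V s1 hs1 (by omega)
      refine ⟨B, hBU, hBc.le, m, hm, h2, ?_⟩
      have := Finset.card_nsmul_le_sum B (fun i => |h i|) m h1
      rw [hBc, nsmul_eq_mul] at this
      exact this
  set U := V \ T1 with hU
  have hT1U : Disjoint T1 U := Finset.disjoint_sdiff
  have hT1Uu : T1 ∪ U = V := Finset.union_sdiff_of_subset hT1V
  have hST1 : Disjoint S T1 := hSV.mono_right hT1V
  have hUV : U ⊆ V := Finset.sdiff_subset
  have hWU : Disjoint (S ∪ T1) U := Finset.disjoint_union_left.mpr ⟨hSV.mono_right hUV, hT1U⟩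
  have hWUu : (S ∪ T1) ∪ U = Finset.univ := by rw [Finset.union_assoc, hT1Uu, hSVu]
  have hlV : l1normOn V h = l1normOn T1 h + l1normOn U h := by rw [← l1_union hT1U, hT1Uu]
  set u := nn (S ∪ T1) h with hu
  have hu0 : 0 ≤ u := nn_nonneg _ _
  have hu2 : u ^ 2 = nn S h ^ 2 + nn T1 h ^ 2 := by
    rw [hu, nn_sq, nn_sq, nn_sq, Finset.sum_union hST1]
  have hSu : nn S h ≤ u := by
    apply abs_le_of_sq_le_sq' _ hu0 |>.2
    linarith [sq_nonneg (nn T1 h)]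
  set τ := l1normOn U h / Real.sqrt s + Real.sqrt s * M / 4 with hτ
  have hsq0 : 0 < Real.sqrt s := Real.sqrt_pos.mpr hs'
  have hsq2 : Real.sqrt s * Real.sqrt s = s := Real.mul_self_sqrt hs'.le
  have haq0 : 0 < Real.sqrt (a * k) := Real.sqrt_pos.mpr hak
  have hτ0 : 0 ≤ τ := by have := l1_nonneg U h; positivity
  have hτ1 : τ ≤ l1normOn V h / Real.sqrt s := by
    rw [hlV, hτ, le_div_iff₀ hsq0, add_mul, div_mul_cancel₀ _ hsq0.ne']
    have : (s:ℝ) ≤ 4 * s1 := by exact_mod_cast hss1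
    have e0 : Real.sqrt s * M / 4 * Real.sqrt s = s * M / 4 := by
      linear_combination M / 4 * hsq2
    linarith [mul_le_mul_of_nonneg_right this hM0]
  set σ := l1normOn V x with hσ
  have hσ0 : 0 ≤ σ := l1_nonneg _ _
  set R := Real.sqrt ((k:ℝ) + kT) with hR
  have hR0 : 0 ≤ R := Real.sqrt_nonneg _
  have hlS : l1normOn S h ≤ R * u := by
    have := cs_l1 S h
    rw [hScard] at this
    push_cast at this
    rw [add_comm (kT:ℝ)] at this
    exact this.trans (mul_le_mul_of_nonneg_left hSu hR0)
  have hγR : γ = R / Real.sqrt (a * k) := by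
    rw [hγ, hR, ← Real.sqrt_div' _ hak.le]
    congr 1; field_simp
  have hγ0 : 0 ≤ γ := by rw [hγ]; exact Real.sqrt_nonneg _
  set Y := ∑ i, A.mulVec h i ^ 2 with hY
  have hY0 : 0 ≤ Y := Finset.sum_nonneg fun _ _ => sq_nonneg _
  have hYle : Y ≤ 3 * lam * R * u + 4 * lam * σ := by
    have := mul_nonneg hl0.le (l1_nonneg V h)
    have := mul_le_mul_of_nonneg_left hlS hl0.le
    linarith
  have hVle : l1normOn V h ≤ 3 * (R * u) + 4 * σ := by
    have : lam * l1normOn V h ≤ lam * (3 * (R * u) + 4 * σ) := by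
      have := mul_le_mul_of_nonneg_left hlS hl0.le
      linarith
    exact le_of_mul_le_mul_left this hl0
  set D := σ / Real.sqrt (a * k) with hD
  have hD0 : 0 ≤ D := by positivity
  have hτ2 : τ ≤ 3 * γ * u + 4 * D := by
    calc τ ≤ _ := hτ1
      _ ≤ l1normOn V h / Real.sqrt (a * k) :=
        div_le_div_of_nonneg_left (l1_nonneg _ _) haq0 (Real.sqrt_le_sqrt hsak)
      _ ≤ (3 * (R * u) + 4 * σ) / Real.sqrt (a * k) := div_le_div_of_nonneg_right hVle haq0.le
      _ = _ := by rw [hγR, hD]; ring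
  -- norm of h
  have hnorm : l2norm h ≤ u + τ := by
    have h1 : nn U h ≤ τ := flat_bound U h s hs M hM0 hM
    have h2 : ∑ i, h i ^ 2 = u ^ 2 + nn U h ^ 2 := by
      rw [hu, nn_sq, nn_sq, ← Finset.sum_union hWU, hWUu]
    have h3 := nn_nonneg U h
    apply Real.sqrt_le_iff.mpr
    refine ⟨by positivity, ?_⟩
    rw [h2]
    linarith [mul_nonneg hu0 hτ0, pow_le_pow_left₀ h3 h1 2]
  have hr2 : Real.sqrt 2 ^ 2 = 2 := Real.sq_sqrt (by norm_num)
  have hr0 : 0 ≤ Real.sqrt 2 := Real.sqrt_nonneg _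
  have hδ1 : δ < 1 := by
    have : 0 ≤ 3 * Real.sqrt 2 * γ * δ := by positivity
    linarith
  -- the tail inner product
  set c := δ * (nn S h + nn T1 h) with hc
  have hS0' := nn_nonneg S h
  have hT0' := nn_nonneg T1 h
  have hc0 : 0 ≤ c := by positivity
  have hcu : c ≤ δ * (Real.sqrt 2 * u) := by
    apply mul_le_mul_of_nonneg_left _ hδ0.le
    apply abs_le_of_sq_le_sq' _ (by positivity) |>.2
    rw [mul_pow, hr2, hu2]
    linarith [sq_nonneg (nn S h - nn T1 h)]
  have htail := tail_bound_s6 h s hs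
    (fun B => -(A.mulVec (rst (S ∪ T1) h) ⬝ᵥ A.mulVec (rst B h))) c hc0
    (by
      intro B C hBC
      rw [rst_union hBC, Matrix.mulVec_add, dotProduct_add]
      linarith)
    U
    (by
      intro B hB hBs
      rw [rst_union hST1, Matrix.mulVec_add, add_dotProduct]
      have i1 := rip_inner_s6 A _ δ hδ0 hRIP h S B (hSV.mono_right (hB.trans hUV)) (by omega)
      have i2 := rip_inner_s6 A _ δ hδ0 hRIP h T1 B (hT1U.mono_right hB) (by omega)
      have := (abs_le.mp i1).1
      have := (abs_le.mp i2).1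
      rw [hc]
      linarith)
    U.card U M subset_rfl le_rfl hM0 hM
  rw [← hτ] at htail
  have hspW : Sparse (Nat.ceil K) (rst (S ∪ T1) h) := by
    refine ⟨S ∪ T1, (Finset.card_union_le _ _).trans (by omega), ?_⟩
    intro i hi
    simp [rst, hi]
  obtain ⟨lo, hi⟩ := hRIP _ hspW
  rw [rst_sq, ← nn_sq (S ∪ T1), ← hu] at lo hi
  set G := ∑ i, A.mulVec (rst (S ∪ T1) h) i ^ 2 with hG
  have hhsplit : h = rst (S ∪ T1) h + rst U h := by
    rw [← rst_union hWU, hWUu]; funext i; simp [rst]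
  have hGdot : G = A.mulVec (rst (S ∪ T1) h) ⬝ᵥ A.mulVec h +
      -(A.mulVec (rst (S ∪ T1) h) ⬝ᵥ A.mulVec (rst U h)) := by
    have : A.mulVec h = A.mulVec (rst (S ∪ T1) h) + A.mulVec (rst U h) := by
      rw [← Matrix.mulVec_add, ← hhsplit]
    rw [this, dotProduct_add, add_neg_cancel_right, hG, dotProduct]
    exact Finset.sum_congr rfl fun i _ => sq _
  have hcs := cs_dot (A.mulVec (rst (S ∪ T1) h)) (A.mulVec h)
  rw [← hG, ← hY] at hcs
  have hGu : Real.sqrt G ≤ Real.sqrt (1 + δ) * u := by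
    conv_rhs => rw [← Real.sqrt_sq hu0, ← Real.sqrt_mul (by positivity)]
    exact Real.sqrt_le_sqrt hi
  have hmain : (1 - δ) * u ^ 2 ≤ u * (Real.sqrt (1 + δ) * Real.sqrt Y + δ * Real.sqrt 2 * τ) := by
    have e1 := mul_le_mul_of_nonneg_right hGu (Real.sqrt_nonneg Y)
    have e2 := mul_le_mul_of_nonneg_right hcu hτ0
    linarith
  have hmain2 : (1 - β) * u ≤ Real.sqrt (1 + δ) * Real.sqrt Y + 4 * Real.sqrt 2 * δ * D := by
    have e3 : (1 - δ) * u ≤ Real.sqrt (1 + δ) * Real.sqrt Y + δ * Real.sqrt 2 * τ := by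
      rcases hu0.eq_or_lt with h0 | h0
      · rw [← h0, mul_zero]; positivity
      · apply le_of_mul_le_mul_left _ h0
        linarith
    have e4 := mul_le_mul_of_nonneg_left hτ2 (show 0 ≤ δ * Real.sqrt 2 by positivity)
    rw [hβ]
    linarith
  have hb0 : 0 < 1 - β := by linarith
  have hZ2 : (Real.sqrt (1 + δ) * Real.sqrt Y) ^ 2 ≤
      (3 * (1 + δ) * (lam * R) / (1 - β)) * ((1 - β) * u) +
        (2 * Real.sqrt 2 * Real.sqrt (lam * σ)) ^ 2 := by
    rw [mul_pow, Real.sq_sqrt (by linarith), Real.sq_sqrt hY0, mul_pow, mul_pow, hr2,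
      Real.sq_sqrt (by positivity)]
    have e5 : (3 * (1 + δ) * (lam * R) / (1 - β)) * ((1 - β) * u) = 3 * (1 + δ) * (lam * R) * u := by
      field_simp
    rw [e5]
    have e6 := mul_le_mul_of_nonneg_left hYle (show 0 ≤ 1 + δ by linarith)
    have e7 : 0 ≤ (1 - δ) * (lam * σ) := mul_nonneg (by linarith) (by positivity)
    linarith
  have hfin := scalar (by positivity) (by positivity) (by positivity) hmain2 hZ2
  have h14 : 1.4 * (4 * Real.sqrt 2 * δ * D) ≤ 8 * δ * D := by
    have : (1.4:ℝ) * Real.sqrt 2 ≤ 2 := by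
      have : Real.sqrt 2 ≤ 1.42 := Real.sqrt_le_iff.mpr ⟨by norm_num, by norm_num⟩
      linarith
    have := mul_le_mul_of_nonneg_right this (show 0 ≤ 4 * δ * D by positivity)
    linarith
  have hu_le : u ≤ (2 * (3 * (1 + δ) * (lam * R) / (1 - β)) +
      2 * Real.sqrt 2 * Real.sqrt (lam * σ) + 8 * δ * D) / (1 - β) := by
    rw [le_div_iff₀ hb0]; linarith
  calc l2norm h ≤ (3 * γ + 1) * u + 4 * D := by linarith
    _ ≤ (3 * γ + 1) * ((2 * (3 * (1 + δ) * (lam * R) / (1 - β)) +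
      2 * Real.sqrt 2 * Real.sqrt (lam * σ) + 8 * δ * D) / (1 - β)) + 4 * D := by
        gcongr
    _ = _ := by field_simp; ring
end

section
/- Let T ⊆ {1,…,n}, x ∈ ℝⁿ, w ∈ ℝ^m, y = Ax + w, and λ > 2‖Aᵀw‖_∞. Let ẑ be a global minimizer of the tail-lasso objective f(z) = ½‖Az − y‖₂² + λ‖z_{T^c}‖₁, set h = ẑ − x, and let S₀ ⊆ T^c be a set of k indices of the largest-magnitude entries of x_{T^c}. Then 0 ≤ ‖Ah‖₂² ≤ λ(3‖h_{T ∪ S₀}‖₁ − ‖h_{T^c ∩ S₀^c}‖₁ + 4‖x_{T^c ∩ S₀^c}‖₁); in particular, ‖h_{T^c ∩ S₀^c}‖₁ ≤ 3‖h_{T ∪ S₀}‖₁ + 4‖x_{T^c ∩ S₀^c}‖₁. -/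
open scoped BigOperators
open Matrix

theorem stmt7 {m n : ℕ} (A : Matrix (Fin m) (Fin n) ℝ)
    (T : Finset (Fin n)) (x : Fin n → ℝ) (w : Fin m → ℝ)
    (y : Fin m → ℝ) (hy : y = A.mulVec x + w)
    (lam : ℝ) (hlam : lam > 2 * linfnorm (Aᵀ.mulVec w))
    -- `zhat` is a global minimizer of the tail-lasso objective
    (zhat : Fin n → ℝ)
    (hopt : ∀ z : Fin n → ℝ, tailLasso A y T lam zhat ≤ tailLasso A y T lam z)
    (h : Fin n → ℝ) (hh : h = zhat - x)
    -- `S₀ ⊆ Tᶜ` is a set of `k` indices of the largest-magnitude entries of `x` on `Tᶜ`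
    (k : ℕ) (S0 : Finset (Fin n)) (hS0T : S0 ⊆ Tᶜ) (hS0card : S0.card = k)
    (hS0max : ∀ i ∈ S0, ∀ j ∈ Tᶜ \ S0, |x j| ≤ |x i|) :
    (0 ≤ ∑ i, A.mulVec h i ^ 2) ∧
      (∑ i, A.mulVec h i ^ 2) ≤
        lam * (3 * l1normOn (T ∪ S0) h - l1normOn (Tᶜ \ S0) h + 4 * l1normOn (Tᶜ \ S0) x) ∧
      l1normOn (Tᶜ \ S0) h ≤ 3 * l1normOn (T ∪ S0) h + 4 * l1normOn (Tᶜ \ S0) x := by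
  have hl : 0 < lam := lt_of_le_of_lt (mul_nonneg (by norm_num) (norm_nonneg _)) hlam
  have hz : zhat = x + h := by rw [hh]; abel
  have h1 := hopt x
  -- inner product bound
  have hip : ∑ i, A.mulVec h i * w i ≤ lam / 2 * ∑ j, |h j| := by
    have e : ∑ i, A.mulVec h i * w i = ∑ j, h j * Aᵀ.mulVec w j := by
      change A.mulVec h ⬝ᵥ w = h ⬝ᵥ Aᵀ.mulVec w
      rw [Matrix.mulVec_transpose, dotProduct_comm, Matrix.dotProduct_mulVec, dotProduct_comm]
    rw [e, Finset.mul_sum]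
    refine Finset.sum_le_sum fun j _ => ?_
    have hb : |Aᵀ.mulVec w j| ≤ lam / 2 := by
      have := norm_le_pi_norm (Aᵀ.mulVec w) j
      rw [Real.norm_eq_abs] at this
      unfold linfnorm at hlam
      linarith
    calc h j * Aᵀ.mulVec w j ≤ |h j * Aᵀ.mulVec w j| := le_abs_self _
      _ = |Aᵀ.mulVec w j| * |h j| := by rw [abs_mul, mul_comm]
      _ ≤ lam / 2 * |h j| := mul_le_mul_of_nonneg_right hb (abs_nonneg _)
  have hq : ∑ i, (A.mulVec zhat i - y i) ^ 2 - ∑ i, (A.mulVec x i - y i) ^ 2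
      = ∑ i, A.mulVec h i ^ 2 - 2 * ∑ i, A.mulVec h i * w i := by
    rw [Finset.mul_sum, ← Finset.sum_sub_distrib, ← Finset.sum_sub_distrib]
    refine Finset.sum_congr rfl fun i _ => ?_
    rw [hz, hy, Matrix.mulVec_add]
    simp only [Pi.add_apply]
    ring
  have hsplit : ∀ v : Fin n → ℝ, l1normOn Tᶜ v = l1normOn S0 v + l1normOn (Tᶜ \ S0) v := by
    intro v
    unfold l1normOn
    rw [add_comm, Finset.sum_sdiff hS0T]
  have htot : ∑ j, |h j| = l1normOn T h + l1normOn Tᶜ h := by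
    unfold l1normOn
    rw [Finset.sum_add_sum_compl]
  have hun : l1normOn (T ∪ S0) h = l1normOn T h + l1normOn S0 h := by
    unfold l1normOn
    refine Finset.sum_union ?_
    exact (Finset.subset_compl_iff_disjoint_left.mp hS0T)
  have hT : 0 ≤ l1normOn T h := Finset.sum_nonneg fun _ _ => abs_nonneg _
  have hS : l1normOn S0 x ≤ l1normOn S0 zhat + l1normOn S0 h := by
    unfold l1normOn
    rw [← Finset.sum_add_distrib]
    refine Finset.sum_le_sum fun j _ => ?_
    have e : x j = zhat j - h j := by rw [hh]; simp
    rw [e]; exact norm_sub_le (zhat j) (h j)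
  have hR : l1normOn (Tᶜ \ S0) h ≤ l1normOn (Tᶜ \ S0) zhat + l1normOn (Tᶜ \ S0) x := by
    unfold l1normOn
    rw [← Finset.sum_add_distrib]
    refine Finset.sum_le_sum fun j _ => ?_
    rw [hh]; exact norm_sub_le (zhat j) (x j)
  have h0 : 0 ≤ ∑ i, A.mulVec h i ^ 2 := Finset.sum_nonneg fun _ _ => sq_nonneg _
  have hmain : (∑ i, A.mulVec h i ^ 2) ≤
        lam * (3 * l1normOn (T ∪ S0) h - l1normOn (Tᶜ \ S0) h + 4 * l1normOn (Tᶜ \ S0) x) := by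
    unfold tailLasso at h1
    rw [hsplit, hsplit] at h1
    rw [htot, hsplit] at hip
    rw [hun]
    have a1 := mul_nonneg hl.le hT
    have a2 := mul_le_mul_of_nonneg_left hS hl.le
    have a3 := mul_le_mul_of_nonneg_left hR hl.le
    linarith
  refine ⟨h0, hmain, ?_⟩
  have := nonneg_of_mul_nonneg_right (h0.trans hmain) hl
  linarith
end

section
/- For any matrix A ∈ ℝ^{m×n}, any vector y ∈ ℝ^m, any index set T ⊆ {1,…,n}, and any λ > 0, the infimum over z ∈ ℝⁿ of f(z) = ½‖Az − y‖₂² + λ‖z_{T^c}‖₁ equals the infimum over (u,v) ∈ ℝⁿ×ℝⁿ of g(u,v) = ½‖A(u∘v) − y‖₂² + (λ/2)(‖u_{T^c}‖₂² + ‖v_{T^c}‖₂²). -/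
open scoped BigOperators

/-- The Hadamard product parametrization objective
`g(u,v) = ½‖A(u∘v) − y‖₂² + (λ/2)(‖u_{Tᶜ}‖₂² + ‖v_{Tᶜ}‖₂²)`. -/
noncomputable def hppObj {m n : ℕ} (A : Matrix (Fin m) (Fin n) ℝ) (y : Fin m → ℝ)
    (T : Finset (Fin n)) (lam : ℝ) (u v : Fin n → ℝ) : ℝ :=
  (∑ i, (A.mulVec (fun j => u j * v j) i - y i) ^ 2) / 2
    + lam / 2 * ((∑ j ∈ Tᶜ, u j ^ 2) + ∑ j ∈ Tᶜ, v j ^ 2)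

theorem stmt8 {m n : ℕ} (A : Matrix (Fin m) (Fin n) ℝ) (y : Fin m → ℝ)
    (T : Finset (Fin n)) (lam : ℝ) (hlam : 0 < lam) :
    (⨅ z : Fin n → ℝ, tailLasso A y T lam z)
      = ⨅ p : (Fin n → ℝ) × (Fin n → ℝ), hppObj A y T lam p.1 p.2 := by
  have hf : BddBelow (Set.range fun z : Fin n → ℝ => tailLasso A y T lam z) := by
    refine ⟨0, ?_⟩
    rintro _ ⟨z, rfl⟩
    simp only [tailLasso, l1normOn]
    positivity
  have hg : BddBelow (Set.range fun p : (Fin n → ℝ) × (Fin n → ℝ) =>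
      hppObj A y T lam p.1 p.2) := by
    refine ⟨0, ?_⟩
    rintro _ ⟨p, rfl⟩
    simp only [hppObj]
    positivity
  apply le_antisymm
  · refine le_ciInf fun p => ?_
    refine (ciInf_le hf (fun j => p.1 j * p.2 j)).trans ?_
    simp only [tailLasso, hppObj, l1normOn]
    have h : ∑ j ∈ Tᶜ, |p.1 j * p.2 j|
        ≤ ∑ j ∈ Tᶜ, ((p.1 j ^ 2 + p.2 j ^ 2) / 2) := by
      refine Finset.sum_le_sum fun j _ => ?_
      rw [abs_mul, ← sq_abs (p.1 j), ← sq_abs (p.2 j)]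
      nlinarith [sq_nonneg (|p.1 j| - |p.2 j|)]
    rw [← Finset.sum_div, Finset.sum_add_distrib] at h
    have := mul_le_mul_of_nonneg_left h hlam.le
    linarith
  · refine le_ciInf fun z => ?_
    refine (ciInf_le hg (fun j => SignType.sign (z j) * √|z j|, fun j => √|z j|)).trans ?_
    have h1 : ∀ j, (SignType.sign (z j) : ℝ) * √|z j| * √|z j| = z j := fun j => by
      rw [mul_assoc, Real.mul_self_sqrt (abs_nonneg _), sign_mul_abs]
    have h2 : ∀ j, ((SignType.sign (z j) : ℝ) * √|z j|) ^ 2 = |z j| := fun j => by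
      rw [mul_pow, Real.sq_sqrt (abs_nonneg _)]
      rcases lt_trichotomy (z j) 0 with h | h | h <;> simp [h]
    have h3 : ∀ j, (√|z j|) ^ 2 = |z j| := fun j => Real.sq_sqrt (abs_nonneg _)
    simp only [tailLasso, hppObj, l1normOn, h1, h2, h3]
    apply le_of_eq
    ring
end

section
/- Let A ∈ ℝ^{m×n}, y ∈ ℝ^m, T ⊆ {1,…,n}, λ > 0. Suppose ẑ ∈ ℝⁿ is a global minimizer of f(z) = ½‖Az − y‖₂² + λ‖z_{T^c}‖₁. Define û, v̂ ∈ ℝⁿ by û_j = sign(ẑ_j)√|ẑ_j| and v̂_j = √|ẑ_j| for all j. Then û∘v̂ = ẑ, g(û, v̂) = f(ẑ), and (û, v̂) is a global minimizer of g. -/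
open scoped BigOperators

theorem stmt9 {m n : ℕ} (A : Matrix (Fin m) (Fin n) ℝ) (y : Fin m → ℝ)
    (T : Finset (Fin n)) (lam : ℝ) (hlam : 0 < lam)
    -- `zhat` is a global minimizer of the tail-lasso objective
    (zhat : Fin n → ℝ)
    (hopt : ∀ z : Fin n → ℝ, tailLasso A y T lam zhat ≤ tailLasso A y T lam z)
    (uhat vhat : Fin n → ℝ)
    (hu : ∀ j, uhat j = Real.sign (zhat j) * Real.sqrt |zhat j|)
    (hv : ∀ j, vhat j = Real.sqrt |zhat j|) :
    (fun j => uhat j * vhat j) = zhat ∧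
      hppObj A y T lam uhat vhat = tailLasso A y T lam zhat ∧
      ∀ u v : Fin n → ℝ, hppObj A y T lam uhat vhat ≤ hppObj A y T lam u v := by
  have hprod : (fun j => uhat j * vhat j) = zhat := by
    funext j
    rw [hu, hv, mul_assoc, Real.mul_self_sqrt (abs_nonneg _)]
    rcases lt_trichotomy (zhat j) 0 with h | h | h
    · rw [Real.sign_of_neg h, abs_of_neg h]; ring
    · simp [h]
    · rw [Real.sign_of_pos h, abs_of_pos h]; ring
  have hv2 : ∀ j, vhat j ^ 2 = |zhat j| := fun j => by
    rw [hv, Real.sq_sqrt (abs_nonneg _)]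
  have hu2 : ∀ j, uhat j ^ 2 = |zhat j| := fun j => by
    rw [hu, mul_pow, Real.sq_sqrt (abs_nonneg _)]
    rcases lt_trichotomy (zhat j) 0 with h | h | h
    · rw [Real.sign_of_neg h]; ring
    · simp [h]
    · rw [Real.sign_of_pos h]; ring
  have heq : hppObj A y T lam uhat vhat = tailLasso A y T lam zhat := by
    unfold hppObj tailLasso l1normOn
    rw [hprod]
    simp only [hu2, hv2]
    ring
  refine ⟨hprod, heq, fun u v => ?_⟩
  rw [heq]
  refine (hopt (fun j => u j * v j)).trans ?_
  unfold hppObj tailLasso l1normOn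
  have key : 2 * ∑ j ∈ Tᶜ, |u j * v j| ≤ (∑ j ∈ Tᶜ, u j ^ 2) + ∑ j ∈ Tᶜ, v j ^ 2 := by
    rw [← Finset.sum_add_distrib, Finset.mul_sum]
    refine Finset.sum_le_sum fun j _ => ?_
    rw [abs_mul, ← sq_abs (u j), ← sq_abs (v j)]
    nlinarith [sq_nonneg (|u j| - |v j|)]
  have := mul_le_mul_of_nonneg_left key (half_pos hlam).le
  linarith
end
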